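/- There exists N such that for every odd n ≥ N, every proper edge colouring of the complete graph K_n on n vertices using at most n colours contains a Hamiltonian path whose edges use at most (log(n+1))^3 distinct colours. -/

import Mathlib

/-- An edge colouring `c` (given as a function on unordered pairs of vertices) is proper if
no two distinct edges sharing a vertex receive the same colour. -/
def IsProperEdgeColoring {V α : Type*} (c : Sym2 V → α) : Prop :=
  ∀ e₁ e₂ : Sym2 V, ¬ e₁.IsDiag → ¬ e₂.IsDiag → e₁ ≠ e₂ →
    (∃ v, v ∈ e₁ ∧ v ∈ e₂) → c e₁ ≠ c e₂

section

open scoped Classical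

/-- The list `S` occurs, forwards or backwards, as a contiguous block of `l`. -/
def Unbroken {V : Type*} (S l : List V) : Prop := S <:+: l ∨ S.reverse <:+: l

theorem Unbroken.reverse_right {V : Type*} {S l : List V} (h : Unbroken S l) :
    Unbroken S l.reverse := by
  rcases h with h | h
  · exact Or.inr (List.reverse_infix.2 h)
  · exact Or.inl (by simpa using List.reverse_infix.2 h)

theorem Unbroken.trans {V : Type*} {S T l : List V} (h : Unbroken S T) (h' : Unbroken T l) :
    Unbroken S l := by
  rcases h' with h' | h'
  · exact h.imp (fun h => h.trans h') (fun h => h.trans h')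
  · exact (h.reverse_right).imp (fun h => h.trans h') (fun h => h.trans h')

theorem Unbroken.mem {V : Type*} {S l : List V} (h : Unbroken S l) {v : V} (hv : v ∈ S) :
    v ∈ l := by
  rcases h with h | h
  · exact h.subset hv
  · exact h.subset (List.mem_reverse.2 hv)

theorem infix_rotate {V : Type*} {S A B : List V} {z : V} (hz : z ∉ S)
    (h : S <:+: (A ++ [z]) ++ B) : Unbroken S ((A ++ [z]).reverse ++ B) := by
  rw [List.infix_append_iff] at h
  rcases h with h | h | ⟨S₁, S₂, rfl, h₁, h₂⟩
  · exact Or.inr ((List.reverse_infix.2 h).trans (List.prefix_append _ _).isInfix)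
  · exact Or.inl (h.trans (List.suffix_append _ _).isInfix)
  · rcases List.eq_nil_or_concat S₁ with rfl | ⟨T, w, rfl⟩
    · exact Or.inl (h₂.isInfix.trans (List.suffix_append _ _).isInfix)
    · obtain ⟨C, hC⟩ := h₁
      rw [List.concat_eq_append, ← List.append_assoc] at hC
      have := (List.append_inj' hC rfl).2
      simp_all

theorem Unbroken.rotate {V : Type*} {S A B : List V} {z : V} (hz : z ∉ S)
    (h : Unbroken S ((A ++ [z]) ++ B)) : Unbroken S ((A ++ [z]).reverse ++ B) := by
  rcases h with h | h
  · exact infix_rotate hz h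
  · have := infix_rotate (by simpa using hz) h
    rcases this with h | h
    · exact Or.inr h
    · exact Or.inl (by simpa using h)

/-- `l` is a path of `G` on the vertices of `P`, ending at the same vertex, and every block of `P`
avoiding `Z` is still a block of `l`. -/
structure IsRotation {V : Type*} (G : SimpleGraph V) (P : List V) (Z : Finset V) (l : List V) :
    Prop where
  perm : l.Perm P
  chain : l.IsChain G.Adj
  last : l.getLast? = P.getLast?
  unbroken : ∀ S : List V, (∀ v ∈ S, v ∉ Z) → Unbroken S P → Unbroken S l

theorem IsRotation.refl {V : Type*} {G : SimpleGraph V} {P : List V} (h : P.IsChain G.Adj) :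
    IsRotation G P ∅ P :=
  ⟨List.Perm.refl _, h, rfl, fun _ _ h => h⟩

theorem IsRotation.rotate {V : Type*} {G : SimpleGraph V} {P l : List V} {Z : Finset V}
    (h : IsRotation G P Z l) {x y p q : V} (hx : l.head? = some x) (hxy : G.Adj x y)
    (hU : Unbroken [p, y, q] P) (hp : p ∉ Z) (hy : y ∉ Z) (hq : q ∉ Z) :
    ∃ z, (z = p ∨ z = q) ∧ ∃ l', IsRotation G P (insert z Z) l' ∧ l'.head? = some z := by
  have hl := h.unbroken _ (by simp [hp, hy, hq]) hU
  obtain ⟨z, hz, A, B, rfl⟩ : ∃ z, (z = p ∨ z = q) ∧ ∃ A B, l = (A ++ [z]) ++ (y :: B) := by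
    rcases hl with ⟨A, B, h⟩ | ⟨A, B, h⟩
    · exact ⟨p, Or.inl rfl, A, q :: B, by simp [← h]⟩
    · exact ⟨q, Or.inr rfl, A, p :: B, by simp [← h]⟩
  refine ⟨z, hz, (A ++ [z]).reverse ++ (y :: B), ⟨?_, ?_, ?_, ?_⟩, by simp⟩
  · exact ((List.reverse_perm _).append_right _).trans h.perm
  · have hc := h.chain
    rw [List.isChain_append] at hc ⊢
    refine ⟨?_, hc.2.1, ?_⟩
    · rw [List.isChain_reverse]
      exact hc.1.imp fun a b hab => hab.symm
    · intro u hu v hv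
      rw [List.getLast?_reverse] at hu
      have : (A ++ [z]).head? = some x := by
        rw [List.head?_append_of_ne_nil] at hx
        · exact hx
        · simp
      simp_all
  · rw [← h.last, List.getLast?_append_of_ne_nil _ (by simp),
      List.getLast?_append_of_ne_nil _ (by simp)]
  · intro S hS hSP
    refine Unbroken.rotate ?_ (h.unbroken S (fun v hv hvZ => hS v hv (by simp [hvZ])) hSP)
    intro hzS
    exact hS z hzS (by simp)

theorem infix_pair_unique {V : Type*} {P : List V} (hP : P.Nodup) {x y z : V}
    (h₁ : [x, y] <:+: P) (h₂ : [x, z] <:+: P) : y = z := by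
  obtain ⟨A, B, rfl⟩ := h₁
  obtain ⟨C, D, h⟩ := h₂
  have hA : x ∉ A := by simp [List.nodup_append] at hP; grind
  have hC : x ∉ C := by rw [← h] at hP; simp [List.nodup_append] at hP; grind
  simp only [List.append_assoc, List.cons_append, List.nil_append] at h
  have := (List.append_eq_append_iff).1 h
  rcases this with ⟨E, rfl, h⟩ | ⟨E, rfl, h⟩
  · cases E <;> simp_all
  · cases E <;> simp_all

/-- The first and last entries of a list. -/
noncomputable def listEnds {V : Type*} (P : List V) : Finset V :=
  P.head?.toFinset ∪ P.getLast?.toFinset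

theorem card_listEnds_le {V : Type*} (P : List V) : (listEnds P).card ≤ 2 := by
  refine (Finset.card_union_le _ _).trans ?_
  have : ∀ o : Option V, o.toFinset.card ≤ 1 := by rintro (_ | _) <;> simp
  have h₁ := this P.head?
  have h₂ := this P.getLast?
  omega

theorem exists_triple {V : Type*} {P : List V} {y : V} (hy : y ∈ P) (hy' : y ∉ listEnds P) :
    ∃ p q, [p, y, q] <:+: P := by
  obtain ⟨A, B, rfl⟩ := List.append_of_mem hy
  rcases List.eq_nil_or_concat A with rfl | ⟨A, p, rfl⟩
  · simp [listEnds] at hy'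
  rcases B with _ | ⟨q, B⟩
  · simp [listEnds] at hy'
  exact ⟨p, q, A, B, by simp⟩

section

variable {V : Type*} [Fintype V]

/-- The closed neighbourhood of a set of vertices. -/
noncomputable def nbhd (G : SimpleGraph V) (X : Finset V) : Finset V :=
  Finset.univ.filter fun y => y ∈ X ∨ ∃ x ∈ X, G.Adj x y

/-- The vertices next to a vertex of `X` on the list `P`. -/
noncomputable def listNbhd (P : List V) (X : Finset V) : Finset V :=
  Finset.univ.filter fun y => ∃ x ∈ X, [x, y] <:+: P ∨ [y, x] <:+: P

theorem card_listNbhd_le {P : List V} (hP : P.Nodup) (X : Finset V) :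
    (listNbhd P X).card ≤ 2 * X.card := by
  have key : ∀ P : List V, P.Nodup →
      (Finset.univ.filter fun y => ∃ x ∈ X, [x, y] <:+: P).card ≤ X.card := by
    intro P hP
    have h : ∀ y ∈ Finset.univ.filter (fun y => ∃ x ∈ X, [x, y] <:+: P),
        ∃ x ∈ X, [x, y] <:+: P := fun y hy => by simpa using hy
    choose! f hf using h
    refine Finset.card_le_card_of_injOn f (fun y hy => (hf y hy).1) ?_
    intro y hy z hz hyz
    have h₁ := (hf y hy).2
    have h₂ := (hf z hz).2
    rw [← hyz] at h₂
    exact infix_pair_unique hP h₁ h₂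
  have h₁ := key P hP
  have h₂ := key P.reverse (List.nodup_reverse.2 hP)
  have hsub : listNbhd P X ⊆ (Finset.univ.filter fun y => ∃ x ∈ X, [x, y] <:+: P) ∪
      (Finset.univ.filter fun y => ∃ x ∈ X, [x, y] <:+: P.reverse) := by
    intro y hy
    simp only [listNbhd, Finset.mem_filter, Finset.mem_univ, true_and, Finset.mem_union] at hy ⊢
    obtain ⟨x, hx, h | h⟩ := hy
    · exact Or.inl ⟨x, hx, h⟩
    · exact Or.inr ⟨x, hx, by simpa using List.reverse_infix.2 h⟩
  have := (Finset.card_le_card hsub).trans (Finset.card_union_le _ _)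
  omega

theorem mem_listNbhd_of_triple {P : List V} {X : Finset V} {p y q z : V}
    (h : [p, y, q] <:+: P) (hz : z = p ∨ z = q) (hzX : z ∈ X) : y ∈ listNbhd P X := by
  simp only [listNbhd, Finset.mem_filter, Finset.mem_univ, true_and]
  refine ⟨z, hzX, ?_⟩
  rcases hz with rfl | rfl
  · exact Or.inl (List.IsInfix.trans ⟨[], [q], rfl⟩ h)
  · exact Or.inr (List.IsInfix.trans ⟨[p], [], rfl⟩ h)

/-- Every vertex of `R` is the first vertex of a rotation of `P` with few rotations. -/
theorem exists_many_rotations (G : SimpleGraph V) {P : List V} (hc : P.IsChain G.Adj)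
    (hnd : P.Nodup) {v : V} (hv : P.head? = some v)
    (hmax : ∀ Q : List V, Q.IsChain G.Adj → Q.Nodup → Q.length ≤ P.length) {M s : ℕ}
    (hexp : ∀ X : Finset V, (3 * M + 2) * X.card ≤ (nbhd G X).card ∨
      Fintype.card V ≤ 2 * (nbhd G X).card)
    (hs : 24 * s + 12 ≤ Fintype.card V) (i : ℕ) :
    ∃ R : Finset V, R.Nonempty ∧ (M ^ i ≤ R.card ∨ 4 * s < R.card) ∧ nbhd G R ⊆ P.toFinset ∧
      ∀ z ∈ R, ∃ l Z, Z ⊆ R ∧ Z.card ≤ i ∧ IsRotation G P Z l ∧ l.head? = some z := by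
  have hins : ∀ R : Finset V, (∀ z ∈ R, ∃ l Z, IsRotation G P Z l ∧ l.head? = some z) →
      nbhd G R ⊆ P.toFinset := by
    intro R hR y hy
    simp only [nbhd, Finset.mem_filter, Finset.mem_univ, true_and] at hy
    rw [List.mem_toFinset]
    rcases hy with hy | ⟨x, hx, hxy⟩
    · obtain ⟨l, Z, hl, hlz⟩ := hR y hy
      exact hl.perm.subset (List.mem_of_head? hlz)
    · obtain ⟨l, Z, hl, hlz⟩ := hR x hx
      by_contra hyP
      have := hmax (y :: l) (by
        rw [List.isChain_cons]
        refine ⟨fun w hw => ?_, hl.chain⟩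
        rw [hlz] at hw
        simp only [Option.mem_def, Option.some.injEq] at hw
        exact hw ▸ hxy.symm) (by
        rw [List.nodup_cons]
        exact ⟨fun h => hyP (hl.perm.subset h), hl.perm.nodup_iff.2 hnd⟩)
      rw [List.length_cons, hl.perm.length_eq] at this
      omega
  induction i with
  | zero =>
    have h : ∀ z ∈ ({v} : Finset V), ∃ l Z, Z ⊆ ({v} : Finset V) ∧ Z.card ≤ 0 ∧
        IsRotation G P Z l ∧ l.head? = some z := by
      intro z hz
      rw [Finset.mem_singleton] at hz
      subst hz
      exact ⟨P, ∅, by simp, by simp, IsRotation.refl hc, hv⟩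
    exact ⟨{v}, by simp, by simp, hins _ fun z hz => by
      obtain ⟨l, Z, -, -, h₁, h₂⟩ := h z hz
      exact ⟨l, Z, h₁, h₂⟩, h⟩
  | succ i ih =>
    obtain ⟨R, hne, hcard, hRP, hR⟩ := ih
    by_cases hbig : 4 * s < R.card
    · refine ⟨R, hne, Or.inr hbig, hRP, fun z hz => ?_⟩
      obtain ⟨l, Z, h₁, h₂, h₃⟩ := hR z hz
      exact ⟨l, Z, h₁, by omega, h₃⟩
    let R' := Finset.univ.filter fun z => ∃ l Z, Z ⊆ insert z R ∧ Z.card ≤ i + 1 ∧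
      IsRotation G P Z l ∧ l.head? = some z
    have hsub : R ⊆ R' := by
      intro z hz
      obtain ⟨l, Z, h₁, h₂, h₃⟩ := hR z hz
      simp only [R', Finset.mem_filter, Finset.mem_univ, true_and]
      exact ⟨l, Z, h₁.trans (Finset.subset_insert _ _), by omega, h₃⟩
    have hcov : nbhd G R ⊆ (R' ∪ listNbhd P R') ∪ listEnds P := by
      intro y hy
      have hyP := List.mem_toFinset.1 (hRP hy)
      by_contra hcon
      simp only [Finset.mem_union, not_or] at hcon
      obtain ⟨⟨hyR, hyL⟩, hyE⟩ := hcon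
      obtain ⟨p, q, hpq⟩ := exists_triple hyP hyE
      simp only [nbhd, Finset.mem_filter, Finset.mem_univ, true_and] at hy
      obtain ⟨x, hx, hxy⟩ := hy.resolve_left fun h => hyR (hsub h)
      obtain ⟨l, Z, hZ, hZi, hl, hlx⟩ := hR x hx
      have hp : p ∉ R := fun h => hyL (mem_listNbhd_of_triple hpq (Or.inl rfl) (hsub h))
      have hq : q ∉ R := fun h => hyL (mem_listNbhd_of_triple hpq (Or.inr rfl) (hsub h))
      obtain ⟨z, hz, l', hl', hl'z⟩ := hl.rotate hlx hxy (Or.inl hpq) (fun h => hp (hZ h))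
        (fun h => hyR (hsub (hZ h))) (fun h => hq (hZ h))
      refine hyL (mem_listNbhd_of_triple hpq hz ?_)
      simp only [R', Finset.mem_filter, Finset.mem_univ, true_and]
      exact ⟨l', insert z Z, Finset.insert_subset_insert _ hZ,
        (Finset.card_insert_le _ _).trans (by omega), hl', hl'z⟩
    have h₁ := Finset.card_le_card hcov
    have h₂ := Finset.card_union_le (R' ∪ listNbhd P R') (listEnds P)
    have h₃ := Finset.card_union_le R' (listNbhd P R')
    have h₄ := card_listNbhd_le hnd R'
    have h₅ := card_listEnds_le P
    have h₆ : 0 < R.card := hne.card_pos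
    refine ⟨R', hne.mono hsub, ?_, hins _ fun z hz => ?_, fun z hz => ?_⟩
    · rcases hexp R with h | h
      · left
        have h₇ : M ^ i ≤ R.card := hcard.resolve_right hbig
        have h₈ : M * M ^ i ≤ M * R.card := Nat.mul_le_mul_left _ h₇
        rw [pow_succ']
        have h₉ : (3 * M + 2) * R.card = 3 * (M * R.card) + 2 * R.card := by ring
        omega
      · right
        omega
    · simp only [R', Finset.mem_filter, Finset.mem_univ, true_and] at hz
      obtain ⟨l, Z, -, -, h⟩ := hz
      exact ⟨l, Z, h⟩
    · have hz' := hz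
      simp only [R', Finset.mem_filter, Finset.mem_univ, true_and] at hz
      obtain ⟨l, Z, h₁, h₂⟩ := hz
      exact ⟨l, Z, h₁.trans (Finset.insert_subset hz' hsub), h₂⟩

/-- The vertices of the block `I` that lie in `X`, or are joined to `X`, or are next to `X`
on `I`. -/
noncomputable def blockNbhd (G : SimpleGraph V) (I : List V) (X : Finset V) : Finset V :=
  (nbhd G X ∩ I.toFinset) ∪ listNbhd I X

theorem mem_blockNbhd {G : SimpleGraph V} {I : List V} {X : Finset V} {y : V} :
    y ∈ blockNbhd G I X ↔ ((y ∈ X ∨ ∃ x ∈ X, G.Adj x y) ∧ y ∈ I) ∨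
      ∃ x ∈ X, [x, y] <:+: I ∨ [y, x] <:+: I := by
  simp [blockNbhd, nbhd, listNbhd]

/-- Sets outside the small set `Q` expand into the block `I`. -/
def IsExceptional (G : SimpleGraph V) (s : ℕ) (I : List V) (Q : Finset V) : Prop :=
  Q.card < s ∧ ∀ Y : Finset V, Disjoint Q Y → Y.Nonempty → Y.card ≤ s →
    (blockNbhd G I Q).card + 8 * Y.card < (blockNbhd G I (Q ∪ Y)).card

/-- Any two disjoint sets of `s` vertices are joined by an edge. -/
def JoinsLargeSets (G : SimpleGraph V) (s : ℕ) : Prop :=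
  ∀ A B : Finset V, Disjoint A B → s ≤ A.card → s ≤ B.card → ∃ a ∈ A, ∃ b ∈ B, G.Adj a b

theorem exists_isExceptional {G : SimpleGraph V} {s : ℕ} (hG : JoinsLargeSets G s)
    {I : List V} (hI : I.Nodup) (hlen : 20 * s ≤ I.length) : ∃ Q, IsExceptional G s I Q := by
  let F := Finset.univ.filter fun Q : Finset V =>
    Q.card ≤ 2 * s ∧ (blockNbhd G I Q).card ≤ 8 * Q.card
  have hF : F.Nonempty := by
    refine ⟨∅, ?_⟩
    simp only [F, Finset.mem_filter, Finset.mem_univ, true_and]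
    simp [blockNbhd, nbhd, listNbhd]
  obtain ⟨Q, hQF, hQ⟩ := Finset.exists_max_image F Finset.card hF
  have hQ' : Q.card ≤ 2 * s ∧ (blockNbhd G I Q).card ≤ 8 * Q.card := by simpa [F] using hQF
  have hlt : Q.card < s := by
    by_contra hcon
    by_cases hB : s ≤ (I.toFinset \ blockNbhd G I Q).card
    · obtain ⟨a, ha, b, hb, hab⟩ := hG Q (I.toFinset \ blockNbhd G I Q) (by
        rw [Finset.disjoint_left]
        intro a ha hb
        rw [Finset.mem_sdiff, List.mem_toFinset, mem_blockNbhd] at hb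
        exact hb.2 (Or.inl ⟨Or.inl ha, hb.1⟩)) (by omega) hB
      rw [Finset.mem_sdiff, List.mem_toFinset, mem_blockNbhd] at hb
      exact hb.2 (Or.inl ⟨Or.inr ⟨a, ha, hab⟩, hb.1⟩)
    · have h₁ := Finset.le_card_sdiff (blockNbhd G I Q) I.toFinset
      rw [List.toFinset_card_of_nodup hI] at h₁
      omega
  refine ⟨Q, hlt, fun Y hd hne hY => ?_⟩
  by_contra hcon
  have hcard : (Q ∪ Y).card = Q.card + Y.card := Finset.card_union_of_disjoint hd
  have := hQ (Q ∪ Y) (by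
    simp only [F, Finset.mem_filter, Finset.mem_univ, true_and]
    omega)
  have := hne.card_pos
  omega

/-- The vertex `a` can start rotating inside the block `I`. -/
def Enters (G : SimpleGraph V) (I : List V) (Q : Finset V) (a : V) : Prop :=
  ∃ p y q, [p, y, q] <:+: I ∧ p ∉ Q ∧ q ∉ Q ∧ G.Adj a y

theorem card_not_enters_lt {G : SimpleGraph V} {s : ℕ} (hG : JoinsLargeSets G s)
    {I : List V} (hI : I.Nodup) (hlen : 20 * s ≤ I.length) {Q : Finset V} (hQ : Q.card < s) :
    (Finset.univ.filter fun a => ¬ Enters G I Q a).card < s := by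
  by_contra! hcon
  obtain ⟨B, hB, hBs⟩ := Finset.exists_subset_card_eq hcon
  have h₁ := Finset.le_card_sdiff (listEnds I ∪ listNbhd I Q ∪ B) I.toFinset
  rw [List.toFinset_card_of_nodup hI] at h₁
  have h₂ := Finset.card_union_le (listEnds I ∪ listNbhd I Q) B
  have h₃ := Finset.card_union_le (listEnds I) (listNbhd I Q)
  have h₄ := card_listNbhd_le hI Q
  have h₅ := card_listEnds_le I
  obtain ⟨a, ha, y, hy, hay⟩ := hG B (I.toFinset \ (listEnds I ∪ listNbhd I Q ∪ B)) (by
    rw [Finset.disjoint_left]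
    intro a ha
    simp [ha]) hBs.ge (by omega)
  simp only [Finset.mem_sdiff, Finset.mem_union, List.mem_toFinset, not_or] at hy
  obtain ⟨hyI, ⟨hyE, hyQ⟩, -⟩ := hy
  obtain ⟨p, q, hpq⟩ := exists_triple hyI hyE
  have := hB ha
  simp only [Finset.mem_filter, Finset.mem_univ, true_and] at this
  exact this ⟨p, y, q, hpq, fun h => hyQ (mem_listNbhd_of_triple hpq (Or.inl rfl) h),
    fun h => hyQ (mem_listNbhd_of_triple hpq (Or.inr rfl) h), hay⟩

theorem exists_many_block_rotations (G : SimpleGraph V) {s : ℕ} {X I : List V} {Q : Finset V}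
    (hc : X.IsChain G.Adj) (hIX : Unbroken I X) (hI : I.Nodup) (hQ : IsExceptional G s I Q)
    {a : V} (ha : X.head? = some a) (haI : a ∉ I) (hent : Enters G I Q a) :
    ∃ R : Finset V, s < R.card ∧ ∀ z ∈ R, ∃ l Z, IsRotation G X Z l ∧ l.head? = some z := by
  let F := Finset.univ.filter fun R : Finset V => a ∈ R ∧ Disjoint Q (R.erase a) ∧
    ∀ z ∈ R, ∃ l Z, Z ⊆ R ∧ IsRotation G X Z l ∧ l.head? = some z
  have hF : F.Nonempty := by
    refine ⟨{a}, ?_⟩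
    simp only [F, Finset.mem_filter, Finset.mem_univ, true_and]
    refine ⟨by simp, by simp, fun z hz => ?_⟩
    rw [Finset.mem_singleton] at hz
    subst hz
    exact ⟨X, ∅, by simp, IsRotation.refl hc, ha⟩
  obtain ⟨R, hRF, hmax⟩ := Finset.exists_max_image F Finset.card hF
  obtain ⟨haR, hQR, hR⟩ : a ∈ R ∧ Disjoint Q (R.erase a) ∧
    ∀ z ∈ R, ∃ l Z, Z ⊆ R ∧ IsRotation G X Z l ∧ l.head? = some z := by
    simpa only [F, Finset.mem_filter, Finset.mem_univ, true_and] using hRF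
  -- a rotation at `y` would enlarge `R`
  have step : ∀ x ∈ R, ∀ p y q, G.Adj x y → [p, y, q] <:+: I → p ∉ Q → q ∉ Q →
      p ∈ R ∨ y ∈ R ∨ q ∈ R := by
    intro x hx p y q hxy hpq hp hq
    by_contra! hcon
    obtain ⟨hpR, hyR, hqR⟩ := hcon
    obtain ⟨l, Z, hZ, hl, hlx⟩ := hR x hx
    obtain ⟨z, hz, l', hl', hlz⟩ := hl.rotate hlx hxy (Unbroken.trans (Or.inl hpq) hIX)
      (fun h => hpR (hZ h)) (fun h => hyR (hZ h)) (fun h => hqR (hZ h))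
    have hzR : z ∉ R := by rcases hz with rfl | rfl <;> assumption
    have hzQ : z ∉ Q := by rcases hz with rfl | rfl <;> assumption
    have := hmax (insert z R) (by
      simp only [F, Finset.mem_filter, Finset.mem_univ, true_and]
      refine ⟨by simp [haR], ?_, fun w hw => ?_⟩
      · rw [Finset.disjoint_left] at hQR ⊢
        intro w hw hw'
        rw [Finset.mem_erase, Finset.mem_insert] at hw'
        rcases hw'.2 with rfl | h
        · exact hzQ hw
        · exact hQR hw (Finset.mem_erase.2 ⟨hw'.1, h⟩)
      · rcases Finset.mem_insert.1 hw with rfl | hw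
        · exact ⟨l', insert w Z, Finset.insert_subset_insert _ hZ, hl', hlz⟩
        · obtain ⟨l, Z, hZ, h⟩ := hR w hw
          exact ⟨l, Z, hZ.trans (Finset.subset_insert _ _), h⟩)
    rw [Finset.card_insert_of_notMem hzR] at this
    omega
  refine ⟨R, ?_, fun z hz => ?_⟩
  · have hcR := Finset.card_erase_add_one haR
    have hne : (R.erase a).Nonempty := by
      obtain ⟨p, y, q, hpq, hp, hq, hay⟩ := hent
      have hmem : ∀ w ∈ [p, y, q], w ≠ a := fun w hw h => haI (h ▸ hpq.subset hw)
      rcases step a haR p y q hay hpq hp hq with h | h | h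
      · exact ⟨p, Finset.mem_erase.2 ⟨hmem p (by simp), h⟩⟩
      · exact ⟨y, Finset.mem_erase.2 ⟨hmem y (by simp), h⟩⟩
      · exact ⟨q, Finset.mem_erase.2 ⟨hmem q (by simp), h⟩⟩
    by_contra hcon
    have hexp := hQ.2 _ hQR hne (by omega)
    have hcov : blockNbhd G I (Q ∪ R.erase a) ⊆
        blockNbhd G I Q ∪ ((R ∪ listNbhd I R) ∪ listEnds I) := by
      intro y hy
      simp only [Finset.mem_union]
      by_contra! hcon
      obtain ⟨hyQ, ⟨hyR, hyL⟩, hyE⟩ := hcon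
      rw [mem_blockNbhd] at hy hyQ
      simp only [listNbhd, Finset.mem_filter, Finset.mem_univ, true_and] at hyL
      rcases hy with ⟨h, hyI⟩ | ⟨x, hx, hxy⟩
      · obtain ⟨p, q, hpq⟩ := exists_triple hyI hyE
        have h' : ∃ x ∈ R, G.Adj x y := by
          rcases h with h | ⟨x, hx, hxy⟩
          · rcases Finset.mem_union.1 h with h | h
            · exact absurd (Or.inl ⟨Or.inl h, hyI⟩) hyQ
            · exact absurd (Finset.mem_of_mem_erase h) hyR
          · rcases Finset.mem_union.1 hx with h | h
            · exact absurd (Or.inl ⟨Or.inr ⟨x, h, hxy⟩, hyI⟩) hyQ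
            · exact ⟨x, Finset.mem_of_mem_erase h, hxy⟩
        obtain ⟨x, hx, hxy⟩ := h'
        have hp : [p, y] <:+: I := List.IsInfix.trans ⟨[], [q], rfl⟩ hpq
        have hq : [y, q] <:+: I := List.IsInfix.trans ⟨[p], [], rfl⟩ hpq
        rcases step x hx p y q hxy hpq (fun h => hyQ (Or.inr ⟨p, h, Or.inl hp⟩))
          (fun h => hyQ (Or.inr ⟨q, h, Or.inr hq⟩)) with h | h | h
        · exact hyL ⟨p, h, Or.inl hp⟩
        · exact hyR h
        · exact hyL ⟨q, h, Or.inr hq⟩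
      · rcases Finset.mem_union.1 hx with h | h
        · exact hyQ (Or.inr ⟨x, h, hxy⟩)
        · exact hyL ⟨x, Finset.mem_of_mem_erase h, hxy⟩
    have h₁ := Finset.card_le_card hcov
    have h₂ := Finset.card_union_le (blockNbhd G I Q) ((R ∪ listNbhd I R) ∪ listEnds I)
    have h₃ := Finset.card_union_le (R ∪ listNbhd I R) (listEnds I)
    have h₄ := Finset.card_union_le R (listNbhd I R)
    have h₅ := card_listNbhd_le hI R
    have h₆ := card_listEnds_le I
    have h₇ := hne.card_pos
    omega
  · obtain ⟨l, Z, -, h⟩ := hR z hz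
    exact ⟨l, Z, h⟩

end

theorem exists_blocks {V : Type*} {P : List V} (hP : P.Nodup) {r k : ℕ} (h : r * k ≤ P.length) :
    ∃ I : Fin r → List V, (∀ j, I j <:+: P) ∧ (∀ j, (I j).length = k) ∧
      ∀ i j, i ≠ j → (I i).Disjoint (I j) := by
  refine ⟨fun j => (P.drop (j * k)).take k, fun j => ?_, fun j => ?_, ?_⟩
  · exact (List.take_prefix _ _).isInfix.trans (List.drop_suffix _ _).isInfix
  · rw [List.length_take, List.length_drop]
    have : (j + 1) * k ≤ r * k := Nat.mul_le_mul_right _ (by omega)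
    have : ((j : ℕ) + 1) * k = j * k + k := by ring
    omega
  · have key : ∀ i j : Fin r, i < j →
        ((P.drop (i * k)).take k).Disjoint ((P.drop (j * k)).take k) := by
      intro i j hij v hi hj
      rw [List.take_drop] at hi
      have hle : i * k + k ≤ j * k := by
        have : ((i : ℕ) + 1) * k ≤ j * k := Nat.mul_le_mul_right _ (by omega)
        have : ((i : ℕ) + 1) * k = i * k + k := by ring
        omega
      exact List.disjoint_take_drop hP hle (List.mem_of_mem_drop hi) (List.mem_of_mem_take hj)
    intro i j hij
    rcases lt_or_gt_of_ne hij with h | h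
    · exact key i j h
    · exact (key j i h).symm

theorem infix_append_of_disjoint_left {V : Type*} {A I B J : List V} (hI : I ≠ [])
    (hd : I.Disjoint J) (h : J <:+: (A ++ I) ++ B) : J <:+: A ++ I ∨ J <:+: B := by
  rw [List.infix_append_iff] at h
  rcases h with h | h | ⟨J₁, J₂, rfl, h₁, h₂⟩
  · exact Or.inl h
  · exact Or.inr h
  · rcases List.eq_nil_or_concat J₁ with rfl | ⟨T, w, rfl⟩
    · exact Or.inr h₂.isInfix
    · exfalso
      obtain ⟨T', w', rfl⟩ := (List.eq_nil_or_concat I).resolve_left hI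
      obtain ⟨C, hC⟩ := h₁
      simp only [List.concat_eq_append, ← List.append_assoc] at hC
      have := (List.append_inj' hC rfl).2
      simp only [List.cons.injEq, and_true] at this
      subst this
      exact hd (a := w) (by simp) (by simp)

theorem infix_left_of_disjoint {V : Type*} {A I J : List V} (hJ : J ≠ [])
    (hd : I.Disjoint J) (h : J <:+: A ++ I) : J <:+: A := by
  rw [List.infix_append_iff] at h
  rcases h with h | h | ⟨J₁, J₂, rfl, h₁, h₂⟩
  · exact h
  · obtain ⟨w, hw⟩ := List.exists_mem_of_ne_nil J hJ
    exact absurd hw (hd (h.subset hw))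
  · rcases J₂ with _ | ⟨w, J₂⟩
    · simpa using h₁.isInfix
    · exact absurd (by simp) (hd (h₂.subset (List.mem_cons_self)))

theorem exists_split_of_disjoint {V : Type*} {l I J : List V} (hI : I ≠ []) (hJ : J ≠ [])
    (hd : I.Disjoint J) (hIl : Unbroken I l) (hJl : Unbroken J l) :
    ∃ X Y, l = X ++ Y ∧
      ((Unbroken I X ∧ Unbroken J Y) ∨ (Unbroken J X ∧ Unbroken I Y)) := by
  have key : ∀ I' J' : List V, I' ≠ [] → J' ≠ [] → I'.Disjoint J' → I' <:+: l → J' <:+: l →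
      ∃ X Y, l = X ++ Y ∧ ((I' <:+: X ∧ J' <:+: Y) ∨ (J' <:+: X ∧ I' <:+: Y)) := by
    rintro I' J' hI hJ hd ⟨A, B, rfl⟩ h
    rcases infix_append_of_disjoint_left hI hd h with h | h
    · exact ⟨A, I' ++ B, by simp, Or.inr ⟨infix_left_of_disjoint hJ hd h,
        (List.prefix_append _ _).isInfix⟩⟩
    · exact ⟨A ++ I', B, rfl, Or.inl ⟨(List.suffix_append _ _).isInfix, h⟩⟩
  have hI' : I.reverse ≠ [] := by simpa using hI
  have hJ' : J.reverse ≠ [] := by simpa using hJ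
  have d₁ : I.reverse.Disjoint J := fun v h => hd (List.mem_reverse.1 h)
  have d₂ : I.Disjoint J.reverse := fun v h h' => hd h (List.mem_reverse.1 h')
  have d₃ : I.reverse.Disjoint J.reverse := fun v h => d₂ (List.mem_reverse.1 h)
  rcases hIl with hIl | hIl <;> rcases hJl with hJl | hJl
  · obtain ⟨X, Y, h, h'⟩ := key _ _ hI hJ hd hIl hJl
    exact ⟨X, Y, h, h'.imp (fun h => ⟨Or.inl h.1, Or.inl h.2⟩) fun h => ⟨Or.inl h.1, Or.inl h.2⟩⟩
  · obtain ⟨X, Y, h, h'⟩ := key _ _ hI hJ' d₂ hIl hJl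
    exact ⟨X, Y, h, h'.imp (fun h => ⟨Or.inl h.1, Or.inr h.2⟩) fun h => ⟨Or.inr h.1, Or.inl h.2⟩⟩
  · obtain ⟨X, Y, h, h'⟩ := key _ _ hI' hJ d₁ hIl hJl
    exact ⟨X, Y, h, h'.imp (fun h => ⟨Or.inr h.1, Or.inl h.2⟩) fun h => ⟨Or.inl h.1, Or.inr h.2⟩⟩
  · obtain ⟨X, Y, h, h'⟩ := key _ _ hI' hJ' d₃ hIl hJl
    exact ⟨X, Y, h, h'.imp (fun h => ⟨Or.inr h.1, Or.inr h.2⟩) fun h => ⟨Or.inr h.1, Or.inr h.2⟩⟩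

theorem List.IsChain.reverse_adj {V : Type*} {G : SimpleGraph V} {l : List V}
    (h : l.IsChain G.Adj) : l.reverse.IsChain G.Adj := by
  rw [List.isChain_reverse]
  exact h.imp fun a b hab => hab.symm

theorem card_filter_hit_le {V ι : Type*} [Fintype ι] {I : ι → List V}
    (hd : ∀ i j, i ≠ j → (I i).Disjoint (I j)) (Z : Finset V) :
    (Finset.univ.filter fun j => ∃ v ∈ I j, v ∈ Z).card ≤ Z.card := by
  have h : ∀ j ∈ Finset.univ.filter (fun j => ∃ v ∈ I j, v ∈ Z), ∃ v, v ∈ I j ∧ v ∈ Z :=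
    fun j hj => by simpa using hj
  by_cases hV : Nonempty V
  · choose! f hf using h
    refine Finset.card_le_card_of_injOn f (fun j hj => (hf j hj).2) ?_
    intro i hi j hj hij
    by_contra hne
    exact hd i j hne (hf i hi).1 (hij ▸ (hf j hj).1)
  · rw [Finset.filter_false_of_mem]
    · simp
    · rintro j - ⟨v, -⟩
      exact hV ⟨v⟩

theorem card_filter_often_le {V ι : Type*} [Fintype V] [Fintype ι] [Nonempty ι]
    (r : ι → V → Prop) {s : ℕ} (h : ∀ j, (Finset.univ.filter fun v => ¬ r j v).card ≤ s) :
    (Finset.univ.filter fun v =>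
      Fintype.card ι ≤ 4 * (Finset.univ.filter fun j => ¬ r j v).card).card ≤ 4 * s := by
  set B := Finset.univ.filter fun v =>
      Fintype.card ι ≤ 4 * (Finset.univ.filter fun j => ¬ r j v).card with hB
  have h₁ : B.card * Fintype.card ι ≤ ∑ v ∈ B, 4 * (Finset.univ.filter fun j => ¬ r j v).card := by
    rw [← smul_eq_mul]
    exact Finset.card_nsmul_le_sum _ _ _ fun v hv => by simpa [hB] using hv
  have h₂ : ∑ v, (Finset.univ.filter fun j => ¬ r j v).card
      = ∑ j, (Finset.univ.filter fun v => ¬ r j v).card := by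
    simp only [Finset.card_filter]
    exact Finset.sum_comm
  have h₃ : ∑ j, (Finset.univ.filter fun v => ¬ r j v).card ≤ Fintype.card ι * s := by
    refine (Finset.sum_le_card_nsmul _ _ s fun j _ => h j).trans (by simp)
  have h₄ : ∑ v ∈ B, (Finset.univ.filter fun j => ¬ r j v).card
      ≤ ∑ v, (Finset.univ.filter fun j => ¬ r j v).card :=
    Finset.sum_le_univ_sum_of_nonneg fun _ => Nat.zero_le _
  rw [← Finset.mul_sum] at h₁
  have h₅ : 0 < Fintype.card ι := Fintype.card_pos
  refine le_of_mul_le_mul_left (a := Fintype.card ι) ?_ h₅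
  nlinarith

/-- If a longest path closes up to a cycle and misses a vertex with a neighbour on it, it can be
extended. -/
theorem exists_longer_of_cycle {V : Type*} {G : SimpleGraph V} {l : List V}
    (hc : l.IsChain G.Adj) (hnd : l.Nodup) {x y v w : V} (hx : l.head? = some x)
    (hy : l.getLast? = some y) (hxy : G.Adj x y) (hv : v ∈ l) (hw : w ∉ l) (hvw : G.Adj w v) :
    ∃ Q : List V, Q.IsChain G.Adj ∧ Q.Nodup ∧ Q.length = l.length + 1 := by
  obtain ⟨A, B, rfl⟩ := List.append_of_mem hv
  have hp : (v :: B ++ A).Perm (A ++ v :: B) := List.perm_append_comm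
  refine ⟨w :: (v :: B ++ A), ?_, ?_, ?_⟩
  · rw [List.isChain_append] at hc
    rw [List.isChain_cons, List.isChain_append]
    refine ⟨by simpa using hvw, hc.2.1, hc.1, ?_⟩
    intro a ha b hb
    rw [List.getLast?_append_of_ne_nil _ (by simp), Option.mem_def.1 ha] at hy
    rw [List.head?_append_of_ne_nil _ (by rintro rfl; simp at hb), Option.mem_def.1 hb] at hx
    simp only [Option.some.injEq] at hx hy
    rw [hx, hy]
    exact hxy.symm
  · rw [List.nodup_cons]
    exact ⟨fun h => hw (hp.subset h), hp.nodup_iff.2 hnd⟩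
  · rw [List.length_cons, hp.length_eq]

theorem exists_longest_path {V : Type*} [Fintype V] (G : SimpleGraph V) :
    ∃ P : List V, P.IsChain G.Adj ∧ P.Nodup ∧
      ∀ Q : List V, Q.IsChain G.Adj → Q.Nodup → Q.length ≤ P.length := by
  let p : ℕ → Prop := fun m => ∃ P : List V, P.IsChain G.Adj ∧ P.Nodup ∧ P.length = m
  have h0 : p 0 := ⟨[], by simp, by simp, rfl⟩
  obtain ⟨P, hP₁, hP₂, hP₃⟩ := Nat.findGreatest_spec (P := p) (Nat.zero_le (Fintype.card V)) h0
  refine ⟨P, hP₁, hP₂, fun Q h₁ h₂ => ?_⟩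
  rw [hP₃]
  exact Nat.le_findGreatest h₂.length_le_card ⟨Q, h₁, h₂, rfl⟩

/-- A Hamiltonicity criterion for pseudorandom graphs: sets expand by a factor `3 * M + 2` up to
half of the vertices, and any two disjoint sets of `s` vertices are joined. -/
theorem exists_hamiltonian_list {V : Type*} [Fintype V] (G : SimpleGraph V) {s t M : ℕ}
    (hs : 0 < s) (hG : JoinsLargeSets G s)
    (hexp : ∀ X : Finset V, (3 * M + 2) * X.card ≤ (nbhd G X).card ∨
      Fintype.card V ≤ 2 * (nbhd G X).card)
    (hM : 4 * s < M ^ t) (hcard : (4 * t + 8) * (20 * s) + s ≤ Fintype.card V) :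
    ∃ P : List V, P.IsChain G.Adj ∧ P.Nodup ∧ ∀ v, v ∈ P := by
  have h160 : 160 * s + s ≤ Fintype.card V := by nlinarith
  have hs' : 24 * s + 12 ≤ Fintype.card V := by omega
  obtain ⟨P, hPc, hPnd, hmax⟩ := exists_longest_path G
  refine ⟨P, hPc, hPnd, ?_⟩
  by_contra! hcon
  obtain ⟨w₀, hw₀⟩ := hcon
  have hPne : P ≠ [] := by
    rintro rfl
    have := hmax [w₀] (by simp) (by simp)
    simp at this
  have hhead : ∀ Q : List V, Q.length = P.length → ∃ v, Q.head? = some v := by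
    intro Q hQ
    rcases Q with _ | ⟨v, Q⟩
    · exact absurd (List.length_eq_zero_iff.1 hQ.symm) hPne
    · exact ⟨v, rfl⟩
  obtain ⟨v₁, hv₁⟩ := hhead P rfl
  obtain ⟨R₁, hR₁ne, hR₁, hR₁P, hrot₁⟩ :=
    exists_many_rotations G hPc hPnd hv₁ hmax hexp hs' t
  replace hR₁ : 4 * s < R₁.card := by omega
  have hout : (Finset.univ \ P.toFinset).card < s := by
    by_contra! h
    obtain ⟨a, ha, b, hb, hab⟩ := hG R₁ (Finset.univ \ P.toFinset) (by
      rw [Finset.disjoint_left]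
      intro a ha
      have : a ∈ nbhd G R₁ := by simp [nbhd, ha]
      simp [List.mem_toFinset.1 (hR₁P this)]) (by omega) h
    have hb' : b ∈ nbhd G R₁ := by
      simp only [nbhd, Finset.mem_filter, Finset.mem_univ, true_and]
      exact Or.inr ⟨a, ha, hab⟩
    exact (Finset.mem_sdiff.1 hb).2 (hR₁P hb')
  have hPlen : (4 * t + 8) * (20 * s) ≤ P.length := by
    have h := Finset.le_card_sdiff P.toFinset Finset.univ
    rw [List.toFinset_card_of_nodup hPnd, Finset.card_univ] at h
    omega
  obtain ⟨I, hIP, hIlen, hId⟩ := exists_blocks hPnd hPlen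
  have hInd : ∀ j, (I j).Nodup := fun j => hPnd.sublist (hIP j).sublist
  choose Q hQ using fun j => exists_isExceptional hG (hInd j) (hIlen j).ge
  have hbad := card_filter_often_le (fun j v => Enters G (I j) (Q j) v)
    fun j => (card_not_enters_lt hG (hInd j) (hIlen j).ge (hQ j).1).le
  have hgood : ∀ R : Finset V, 4 * s < R.card → ∃ a ∈ R,
      4 * (Finset.univ.filter fun j => ¬ Enters G (I j) (Q j) a).card < 4 * t + 8 := by
    intro R hR
    obtain ⟨a, haR, ha⟩ := Finset.exists_mem_notMem_of_card_lt_card (hbad.trans_lt hR)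
    refine ⟨a, haR, ?_⟩
    simpa using ha
  obtain ⟨a, haR, ha⟩ := hgood R₁ hR₁
  obtain ⟨l₁, Z₁, -, hZ₁, hl₁, hl₁a⟩ := hrot₁ a haR
  have hlen₁ : l₁.reverse.length = P.length := by rw [List.length_reverse, hl₁.perm.length_eq]
  have hnd₁ : l₁.reverse.Nodup := List.nodup_reverse.2 (hl₁.perm.nodup_iff.2 hPnd)
  obtain ⟨v₂, hv₂⟩ := hhead l₁.reverse hlen₁
  obtain ⟨R₂, -, hR₂, -, hrot₂⟩ := exists_many_rotations G hl₁.chain.reverse_adj hnd₁ hv₂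
    (by rwa [hlen₁]) hexp hs' t
  replace hR₂ : 4 * s < R₂.card := by omega
  obtain ⟨b, hbR, hb⟩ := hgood R₂ hR₂
  obtain ⟨l, Z₂, -, hZ₂, hl, hlb⟩ := hrot₂ b hbR
  have hlP : l.Perm P := hl.perm.trans ((List.reverse_perm _).trans hl₁.perm)
  have hlnd : l.Nodup := hlP.nodup_iff.2 hPnd
  have hla : l.getLast? = some a := by rw [hl.last, List.getLast?_reverse, hl₁a]
  let Z : Finset V := Z₁ ∪ Z₂ ∪ {a, b}
  let J : Finset (Fin (4 * t + 8)) := Finset.univ \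
    ((Finset.univ.filter fun j => ∃ v ∈ I j, v ∈ Z) ∪
      ((Finset.univ.filter fun j => ¬ Enters G (I j) (Q j) a) ∪
        (Finset.univ.filter fun j => ¬ Enters G (I j) (Q j) b)))
  have hJ : 1 < J.card := by
    have h₁ := Finset.le_card_sdiff ((Finset.univ.filter fun j => ∃ v ∈ I j, v ∈ Z) ∪
      ((Finset.univ.filter fun j => ¬ Enters G (I j) (Q j) a) ∪
        (Finset.univ.filter fun j => ¬ Enters G (I j) (Q j) b))) Finset.univ
    have h₂ := Finset.card_union_le (Finset.univ.filter fun j => ∃ v ∈ I j, v ∈ Z)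
      ((Finset.univ.filter fun j => ¬ Enters G (I j) (Q j) a) ∪
        (Finset.univ.filter fun j => ¬ Enters G (I j) (Q j) b))
    have h₃ := Finset.card_union_le (Finset.univ.filter fun j => ¬ Enters G (I j) (Q j) a)
      (Finset.univ.filter fun j => ¬ Enters G (I j) (Q j) b)
    have h₄ := card_filter_hit_le hId Z
    have h₅ : Z.card ≤ (Z₁ ∪ Z₂).card + ({a, b} : Finset V).card := Finset.card_union_le _ _
    have h₆ := Finset.card_union_le Z₁ Z₂
    have h₇ : ({a, b} : Finset V).card ≤ 2 := Finset.card_le_two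
    rw [Finset.card_univ, Fintype.card_fin] at h₁
    change _ ≤ J.card at h₁
    omega
  obtain ⟨i, hi, j, hj, hij⟩ := Finset.one_lt_card.1 hJ
  have hJmem : ∀ j ∈ J, Unbroken (I j) l ∧ a ∉ I j ∧ b ∉ I j ∧
      Enters G (I j) (Q j) a ∧ Enters G (I j) (Q j) b := by
    intro j hj
    simp only [J, Z, Finset.mem_sdiff, Finset.mem_univ, true_and, Finset.mem_union,
      Finset.mem_filter, Finset.mem_insert, Finset.mem_singleton, not_or, not_not] at hj
    obtain ⟨hjZ, hja, hjb⟩ := hj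
    push Not at hjZ
    refine ⟨hl.unbroken _ (fun v hv => (hjZ v hv).1.2) (Unbroken.reverse_right
      (hl₁.unbroken _ (fun v hv => (hjZ v hv).1.1) (Or.inl (hIP j)))),
      fun h => (hjZ a h).2.1 rfl, fun h => (hjZ b h).2.2 rfl, hja, hjb⟩
  have hIne : ∀ j, I j ≠ [] := by
    intro j h
    have := hIlen j
    rw [h, List.length_nil] at this
    omega
  obtain ⟨X, Y, hXY, i, hi, j, hj, hiX, hjY⟩ : ∃ X Y, l = X ++ Y ∧ ∃ i ∈ J, ∃ j ∈ J,
      Unbroken (I i) X ∧ Unbroken (I j) Y := by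
    obtain ⟨X, Y, h, h' | h'⟩ := exists_split_of_disjoint (hIne i) (hIne j) (hId i j hij)
      (hJmem i hi).1 (hJmem j hj).1
    · exact ⟨X, Y, h, i, hi, j, hj, h'⟩
    · exact ⟨X, Y, h, j, hj, i, hi, h'⟩
  subst hXY
  have hXne : X ≠ [] := by
    obtain ⟨v, hv⟩ := List.exists_mem_of_ne_nil _ (hIne i)
    exact List.ne_nil_of_mem (hiX.mem hv)
  have hYne : Y ≠ [] := by
    obtain ⟨v, hv⟩ := List.exists_mem_of_ne_nil _ (hIne j)
    exact List.ne_nil_of_mem (hjY.mem hv)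
  have hc := hl.chain
  rw [List.isChain_append] at hc
  obtain ⟨hXc, hYc, hXYc⟩ := hc
  rw [List.head?_append_of_ne_nil _ hXne] at hlb
  rw [List.getLast?_append_of_ne_nil _ hYne] at hla
  obtain ⟨-, -, hbI, -, hbE⟩ := hJmem i hi
  obtain ⟨-, haI, -, haE, -⟩ := hJmem j hj
  obtain ⟨S₁, hS₁, hX⟩ := exists_many_block_rotations G hXc hiX (hInd i) (hQ i) hlb hbI hbE
  obtain ⟨S₂, hS₂, hY⟩ := exists_many_block_rotations G hYc.reverse_adj hjY.reverse_right
    (hInd j) (hQ j) (by rwa [List.head?_reverse]) haI haE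
  have hdXY := (List.nodup_append.1 hlnd).2.2
  obtain ⟨x, hx, y, hy, hxy⟩ := hG S₁ S₂ (by
    rw [Finset.disjoint_left]
    intro z hz hz'
    obtain ⟨X', _, hX', hX'z⟩ := hX z hz
    obtain ⟨Y', _, hY', hY'z⟩ := hY z hz'
    exact hdXY z (hX'.perm.subset (List.mem_of_head? hX'z)) z
      (List.mem_reverse.1 (hY'.perm.subset (List.mem_of_head? hY'z))) rfl) hS₁.le hS₂.le
  obtain ⟨X', _, hX', hX'x⟩ := hX x hx
  obtain ⟨Y', _, hY', hY'y⟩ := hY y hy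
  have hpY : Y'.reverse.Perm Y :=
    (List.reverse_perm _).trans (hY'.perm.trans (List.reverse_perm _))
  have hp : (X' ++ Y'.reverse).Perm P := (hX'.perm.append hpY).trans hlP
  have hX'ne : X' ≠ [] := by rintro rfl; simp at hX'x
  have hY'ne : Y'.reverse ≠ [] := by
    intro h
    rw [List.reverse_eq_nil_iff] at h
    subst h
    simp at hY'y
  have hcyc : (X' ++ Y'.reverse).IsChain G.Adj := by
    rw [List.isChain_append]
    refine ⟨hX'.chain, hY'.chain.reverse_adj, ?_⟩
    rw [hX'.last, List.head?_reverse, hY'.last, List.getLast?_reverse]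
    exact hXYc
  -- an edge leaving the cycle
  obtain ⟨w, v, hw, hv, hwv⟩ : ∃ w v, w ∉ P ∧ v ∈ P ∧ G.Adj w v := by
    have hpos : 0 < (Finset.univ \ P.toFinset).card :=
      Finset.card_pos.2 ⟨w₀, by simp [hw₀]⟩
    have hlt : (Finset.univ \ P.toFinset).card < (nbhd G (Finset.univ \ P.toFinset)).card := by
      rcases hexp (Finset.univ \ P.toFinset) with h | h
      · nlinarith
      · omega
    obtain ⟨v, hv, hv'⟩ := Finset.exists_mem_notMem_of_card_lt_card hlt
    simp only [nbhd, Finset.mem_filter, Finset.mem_univ, true_and] at hv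
    obtain ⟨w, hw, hwv⟩ := hv.resolve_left hv'
    exact ⟨w, v, by simpa using hw, by simpa using hv', hwv⟩
  obtain ⟨C, hC₁, hC₂, hC₃⟩ := exists_longer_of_cycle hcyc (hp.nodup_iff.2 hPnd)
    (x := x) (y := y) (by rw [List.head?_append_of_ne_nil _ hX'ne, hX'x])
    (by rw [List.getLast?_append_of_ne_nil _ hY'ne, List.getLast?_reverse, hY'y]) hxy
    (hp.mem_iff.2 hv) (fun h => hw (hp.subset h)) hwv
  have := hmax C hC₁ hC₂
  rw [hC₃, hp.length_eq] at this
  omega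

section Words

/-- The position `j` of the word `w` carries a letter not seen before. -/
def IsFirst {k p : ℕ} (w : Fin p → Fin k) (j : Fin p) : Prop := ∀ j' < j, w j' ≠ w j

theorem two_mul_card_isFirst_le {k m : ℕ} {w : Fin (2 * m) → Fin k}
    (hw : ∀ j, ∃ j', j' ≠ j ∧ w j' = w j) :
    (Finset.univ.filter fun j => IsFirst w j).card ≤ m := by
  choose f hf hwf using hw
  have h : (Finset.univ.filter fun j => IsFirst w j).card ≤
      (Finset.univ.filter fun j => ¬ IsFirst w j).card := by
    have hlt : ∀ j, IsFirst w j → j < f j := fun j hj =>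
      lt_of_le_of_ne (not_lt.1 fun h => hj _ h (hwf j)) (hf j).symm
    refine Finset.card_le_card_of_injOn f (fun j hj => ?_) ?_
    · simp only [Finset.coe_filter, Finset.mem_univ, true_and, Set.mem_ofPred_eq] at hj ⊢
      exact fun h => h j (hlt j hj) (hwf j).symm
    · intro i hi j hj hij
      simp only [Finset.coe_filter, Finset.mem_univ, true_and, Set.mem_ofPred_eq] at hi hj
      have hw : w i = w j := by rw [← hwf i, ← hwf j, hij]
      rcases lt_trichotomy i j with h | h | h
      · exact absurd hw (hj i h)
      · exact h
      · exact absurd hw.symm (hi j h)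
  have := Finset.card_filter_add_card_filter_not (s := Finset.univ) (fun j => IsFirst w j)
  rw [Finset.card_univ, Fintype.card_fin] at this
  omega

theorem card_mul_le_sum_pow {α β : Type*} [Fintype β] {p : ℕ} (F : Finset α)
    {code : α → Fin p → β} (hinj : Function.Injective code) {wt : β → ℝ} (hwt : ∀ x, 0 ≤ wt x)
    {b : ℝ} (hF : ∀ w ∈ F, b ≤ ∏ j, wt (code w j)) :
    (F.card : ℝ) * b ≤ (∑ x, wt x) ^ p := by
  have h₁ : (F.card : ℝ) * b ≤ ∑ w ∈ F, ∏ j, wt (code w j) := by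
    simpa using Finset.sum_le_sum hF
  have h₂ : ∑ x ∈ F.image code, ∏ j, wt (x j) = ∑ w ∈ F, ∏ j, wt (code w j) :=
    Finset.sum_image (f := fun x : Fin p → β => ∏ j, wt (x j)) hinj.injOn
  have h₃ : ∑ x ∈ F.image code, ∏ j, wt (x j) ≤ ∑ x : Fin p → β, ∏ j, wt (x j) :=
    Finset.sum_le_univ_sum_of_nonneg fun x => Finset.prod_nonneg fun j _ => hwt _
  rw [Fintype.sum_pow]
  linarith

/-- Few words have no letter occurring exactly once. -/
theorem card_words_le {k m : ℕ} (hm : 0 < m) (hk : 2 * m ≤ k) :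
    ((Finset.univ.filter fun w : Fin (2 * m) → Fin k =>
      ∀ j, ∃ j', j' ≠ j ∧ w j' = w j).card : ℝ) ≤ (8 * m * k) ^ m := by
  set F := Finset.univ.filter fun w : Fin (2 * m) → Fin k => ∀ j, ∃ j', j' ≠ j ∧ w j' = w j
  have hprev : ∀ (w : Fin (2 * m) → Fin k) (j : Fin (2 * m)), ∃ j', ¬ IsFirst w j →
      j' < j ∧ w j' = w j := by
    intro w j
    by_cases h : IsFirst w j
    · exact ⟨j, fun h' => absurd h h'⟩
    · simp only [IsFirst, not_forall, not_not] at h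
      obtain ⟨j', h₁, h₂⟩ := h
      exact ⟨j', fun _ => ⟨h₁, h₂⟩⟩
  choose prev hprev using hprev
  let code : (Fin (2 * m) → Fin k) → Fin (2 * m) → Fin k ⊕ Fin (2 * m) :=
    fun w j => if IsFirst w j then Sum.inl (w j) else Sum.inr (prev w j)
  have hinj : Function.Injective code := by
    intro w w' h
    have key : ∀ (a : ℕ) (j : Fin (2 * m)), (j : ℕ) = a → w j = w' j := by
      intro a
      induction a using Nat.strong_induction_on with
      | _ a ih =>
        intro j hj
        have hcode := congrFun h j
        simp only [code] at hcode
        by_cases h₁ : IsFirst w j <;> by_cases h₂ : IsFirst w' j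
        · simpa [h₁, h₂] using hcode
        · simp [h₁, h₂] at hcode
        · simp [h₁, h₂] at hcode
        · simp only [h₁, h₂, if_false, Sum.inr.injEq] at hcode
          obtain ⟨h₃, h₄⟩ := hprev w j h₁
          obtain ⟨h₅, h₆⟩ := hprev w' j h₂
          rw [← h₄, ← h₆, ← hcode]
          exact ih _ (hj ▸ h₃) _ rfl
    exact funext fun j => key j j rfl
  have hkpos : (0 : ℝ) < k := by exact_mod_cast (by omega : 0 < k)
  have hmpos : (0 : ℝ) < m := by exact_mod_cast hm
  set a : ℝ := 2 * m / k with ha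
  have ha0 : 0 < a := by positivity
  have ha1 : a ≤ 1 := by
    rw [ha, div_le_one hkpos]
    exact_mod_cast hk
  let wt : Fin k ⊕ Fin (2 * m) → ℝ := Sum.elim (fun _ => a) (fun _ => 1)
  have hwt : ∀ x, 0 ≤ wt x := by
    rintro (x | x)
    · exact ha0.le
    · exact zero_le_one
  have hsum : ∑ x, wt x = 4 * m := by
    simp only [Fintype.sum_sum_type, wt, Sum.elim_inl, Sum.elim_inr, Finset.sum_const,
      Finset.card_univ, Fintype.card_fin, nsmul_eq_mul, ha]
    field_simp
    push_cast
    ring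
  have hF : ∀ w ∈ F, a ^ m ≤ ∏ j, wt (code w j) := by
    intro w hw
    have h₁ : ∀ j, wt (code w j) = if IsFirst w j then a else 1 := by
      intro j
      by_cases h : IsFirst w j <;> simp [code, wt, h]
    simp_rw [h₁]
    rw [Finset.prod_ite]
    simp only [Finset.prod_const, one_pow, mul_one]
    exact pow_le_pow_of_le_one ha0.le ha1
      (two_mul_card_isFirst_le (by simpa [F] using hw))
  have hmain : (F.card : ℝ) * a ^ m ≤ (4 * m) ^ (2 * m) :=
    hsum ▸ card_mul_le_sum_pow F hinj hwt hF
  have hfin : (4 * m : ℝ) ^ (2 * m) = (8 * m * k) ^ m * a ^ m := by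
    rw [pow_mul, ← mul_pow, ha]
    congr 1
    field_simp
    ring
  rw [hfin] at hmain
  exact le_of_mul_le_mul_right hmain (by positivity)

end Words

section Trace

variable {V : Type*} [Fintype V]

/-- The matrix with all entries equal to the reciprocal of the dimension. -/
noncomputable def avgMatrix (V : Type*) [Fintype V] : Matrix V V ℝ :=
  Matrix.of fun _ _ => (Fintype.card V : ℝ)⁻¹

theorem avgMatrix_mem [Nonempty V] : avgMatrix V ∈ doublyStochastic ℝ V := by
  rw [mem_doublyStochastic_iff_sum]
  simp [avgMatrix]

theorem mul_avgMatrix {N : Matrix V V ℝ} (hN : N ∈ doublyStochastic ℝ V) :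
    N * avgMatrix V = avgMatrix V := by
  rw [mem_doublyStochastic_iff_sum] at hN
  ext u v
  simp [Matrix.mul_apply, avgMatrix, ← Finset.sum_mul, hN.2.1]

theorem avgMatrix_mul {N : Matrix V V ℝ} (hN : N ∈ doublyStochastic ℝ V) :
    avgMatrix V * N = avgMatrix V := by
  rw [mem_doublyStochastic_iff_sum] at hN
  ext u v
  simp [Matrix.mul_apply, avgMatrix, ← Finset.mul_sum, hN.2.2]

theorem trace_prod_le [Nonempty V] (L : List (Matrix V V ℝ))
    (hL : ∀ B ∈ L, ∃ N ∈ doublyStochastic ℝ V, B = N - avgMatrix V) :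
    L.prod.trace ≤ Fintype.card V := by
  have key : ∃ N ∈ doublyStochastic ℝ V, L.prod = N ∨ L.prod = N - avgMatrix V := by
    induction L with
    | nil => exact ⟨1, one_mem _, Or.inl (by simp)⟩
    | cons B L ih =>
      obtain ⟨N, hN, h⟩ := ih fun B hB => hL B (List.mem_cons_of_mem _ hB)
      obtain ⟨N', hN', rfl⟩ := hL B List.mem_cons_self
      refine ⟨N' * N, mul_mem hN' hN, Or.inr ?_⟩
      rw [List.prod_cons]
      rcases h with h | h
      · rw [h, sub_mul, avgMatrix_mul hN]
      · rw [h, sub_mul, mul_sub, mul_sub, mul_avgMatrix hN', avgMatrix_mul hN,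
          mul_avgMatrix avgMatrix_mem]
        simp
  obtain ⟨N, hN, h⟩ := key
  have hle : N.trace ≤ Fintype.card V := by
    rw [Matrix.trace]
    refine (Finset.sum_le_card_nsmul _ _ 1 fun v _ => ?_).trans (by simp)
    rw [mem_doublyStochastic_iff_sum] at hN
    rw [Matrix.diag_apply, ← hN.2.1 v]
    exact Finset.single_le_sum (f := fun j => N v j) (fun j _ => hN.1 v j) (Finset.mem_univ v)
  rcases h with h | h
  · rwa [h]
  · rw [h, Matrix.trace_sub]
    have : 0 ≤ (avgMatrix V).trace := by
      rw [Matrix.trace]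
      exact Finset.sum_nonneg fun v _ => by simp [avgMatrix]
    linarith

theorem sum_word_eq_zero {ι R : Type*} [Fintype ι] [Ring R] [Algebra ℝ R] {k p : ℕ}
    (B : ι → R) (hB : ∑ x, B x = 0) (w : Fin p → Fin k) (j : Fin p)
    (hj : ∀ j', j' ≠ j → w j' ≠ w j) :
    ∑ c : Fin k → ι, MultilinearMap.mkPiAlgebraFin ℝ p R (fun j => B (c (w j))) = 0 := by
  rw [← (Equiv.funSplitAt (w j) ι).symm.sum_comp, Fintype.sum_prod_type, Finset.sum_comm]
  refine Finset.sum_eq_zero fun g _ => ?_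
  let m : Fin p → R := fun j' => if h : w j' = w j then 0 else B (g ⟨w j', h⟩)
  have : ∀ x : ι, (fun j' => B ((Equiv.funSplitAt (w j) ι).symm (x, g) (w j'))) =
      Function.update m j (B x) := by
    intro x
    funext j'
    by_cases h : j' = j
    · subst h
      simp [Equiv.funSplitAt, Equiv.piSplitAt]
    · simp [Equiv.funSplitAt, Equiv.piSplitAt, h, hj j' h, m]
  simp_rw [this]
  rw [← MultilinearMap.map_update_sum, hB]
  exact MultilinearMap.map_update_zero _ _ _

/-- For a suitable choice of `k` of the matrices `B x`, all high moments of their sum are small. -/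
theorem exists_trace_pow_le [Nonempty V] {ι : Type*} [Fintype ι] [Nonempty ι]
    (B : ι → Matrix V V ℝ) (hB : ∑ x, B x = 0)
    (hBs : ∀ x, ∃ N ∈ doublyStochastic ℝ V, B x = N - avgMatrix V) {k m : ℕ} (hm : 0 < m)
    (hk : 2 * m ≤ k) :
    ∃ c : Fin k → ι, ((∑ i, B (c i)) ^ (2 * m)).trace ≤ Fintype.card V * (8 * m * k) ^ m := by
  let f := MultilinearMap.mkPiAlgebraFin ℝ (2 * m) (Matrix V V ℝ)
  have hpow : ∀ c : Fin k → ι, (∑ i, B (c i)) ^ (2 * m) =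
      ∑ w : Fin (2 * m) → Fin k, f (fun j => B (c (w j))) := by
    intro c
    rw [← MultilinearMap.mkPiAlgebraFin_apply_const (R := ℝ)]
    exact MultilinearMap.map_sum f (fun _ i => B (c i))
  have hsum : ∑ c : Fin k → ι, ((∑ i, B (c i)) ^ (2 * m)).trace ≤
      ∑ _c : Fin k → ι, (Fintype.card V * (8 * m * k) ^ m : ℝ) := by
    simp_rw [hpow, Matrix.trace_sum]
    rw [Finset.sum_comm]
    rw [← Finset.sum_filter_add_sum_filter_not Finset.univ
      (fun w : Fin (2 * m) → Fin k => ∀ j, ∃ j', j' ≠ j ∧ w j' = w j)]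
    have h₀ : ∑ w ∈ Finset.univ.filter (fun w : Fin (2 * m) → Fin k =>
        ¬ ∀ j, ∃ j', j' ≠ j ∧ w j' = w j), ∑ c : Fin k → ι, (f (fun j => B (c (w j)))).trace
        = 0 := by
      refine Finset.sum_eq_zero fun w hw => ?_
      simp only [Finset.mem_filter, Finset.mem_univ, true_and, not_forall, not_exists,
        not_and] at hw
      obtain ⟨j, hj⟩ := hw
      rw [← Matrix.trace_sum, sum_word_eq_zero B hB w j hj, Matrix.trace_zero]
    rw [h₀, add_zero]
    have h₁ : ∀ (w : Fin (2 * m) → Fin k) (c : Fin k → ι),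
        (f (fun j => B (c (w j)))).trace ≤ Fintype.card V := by
      intro w c
      simp only [f, MultilinearMap.mkPiAlgebraFin_apply]
      refine trace_prod_le _ fun A hA => ?_
      obtain ⟨j, rfl⟩ := (List.mem_ofFn' _ _).1 hA
      exact hBs _
    refine (Finset.sum_le_sum fun w _ => Finset.sum_le_sum fun c _ => h₁ w c).trans ?_
    simp only [Finset.sum_const, Finset.card_univ, nsmul_eq_mul]
    have := card_words_le hm hk
    calc _ ≤ ((8 * m * k) ^ m : ℝ) * (Fintype.card (Fin k → ι) * Fintype.card V) := by
          gcongr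
      _ = _ := by ring
  obtain ⟨c, -, hc⟩ := Finset.exists_le_of_sum_le Finset.univ_nonempty hsum
  exact ⟨c, hc⟩

end Trace

section Spectral

open Matrix

variable {V : Type*} [Fintype V]

theorem dotProduct_sq_le (x y : V → ℝ) : (x ⬝ᵥ y) ^ 2 ≤ (x ⬝ᵥ x) * (y ⬝ᵥ y) := by
  have := Finset.sum_mul_sq_le_sq_mul_sq Finset.univ x y
  simpa [dotProduct, sq] using this

theorem mulVec_dotProduct_mulVec {A : Matrix V V ℝ} (hA : A.IsSymm) (x y : V → ℝ) :
    (A *ᵥ x) ⬝ᵥ y = x ⬝ᵥ (A *ᵥ y) := by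
  rw [dotProduct_mulVec, ← mulVec_transpose, hA.eq]

theorem mulVec_norm_le_trace {A : Matrix V V ℝ} (hA : A.IsSymm) (x : V → ℝ) :
    (A *ᵥ x) ⬝ᵥ (A *ᵥ x) ≤ (A ^ 2).trace * (x ⬝ᵥ x) := by
  have h : (A ^ 2).trace = ∑ u, A u ⬝ᵥ A u := by
    rw [sq, Matrix.trace]
    refine Finset.sum_congr rfl fun u _ => ?_
    simp only [Matrix.diag_apply, Matrix.mul_apply, dotProduct]
    exact Finset.sum_congr rfl fun v _ => by rw [hA.apply]
  rw [h, Finset.sum_mul]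
  refine Finset.sum_le_sum fun u _ => ?_
  rw [← sq]
  exact dotProduct_sq_le _ _

theorem mulVec_norm_pow_le {A : Matrix V V ℝ} (hA : A.IsSymm) (x : V → ℝ) (r : ℕ) :
    ((A *ᵥ x) ⬝ᵥ (A *ᵥ x)) ^ 2 ^ r * (x ⬝ᵥ x) ≤
      ((A ^ 2 ^ r *ᵥ x) ⬝ᵥ (A ^ 2 ^ r *ᵥ x)) * (x ⬝ᵥ x) ^ 2 ^ r := by
  have hnn : ∀ y : V → ℝ, 0 ≤ y ⬝ᵥ y := fun y =>
    Finset.sum_nonneg fun u _ => mul_self_nonneg _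
  induction r with
  | zero => simp
  | succ r ih =>
    by_cases hx : x ⬝ᵥ x = 0
    · simp [hx]
    have hpos : 0 < x ⬝ᵥ x := lt_of_le_of_ne (hnn x) (Ne.symm hx)
    set B := A ^ 2 ^ r with hB
    have hBs : B.IsSymm := hA.pow _
    have h₁ : ((B *ᵥ x) ⬝ᵥ (B *ᵥ x)) ^ 2 ≤
        (x ⬝ᵥ x) * ((A ^ 2 ^ (r + 1) *ᵥ x) ⬝ᵥ (A ^ 2 ^ (r + 1) *ᵥ x)) := by
      rw [mulVec_dotProduct_mulVec hBs, mulVec_mulVec, ← sq, hB, ← pow_mul, ← pow_succ]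
      exact dotProduct_sq_le _ _
    have h₂ : (((A *ᵥ x) ⬝ᵥ (A *ᵥ x)) ^ 2 ^ r * (x ⬝ᵥ x)) ^ 2 ≤
        (((B *ᵥ x) ⬝ᵥ (B *ᵥ x)) * (x ⬝ᵥ x) ^ 2 ^ r) ^ 2 :=
      pow_le_pow_left₀ (mul_nonneg (pow_nonneg (hnn _) _) hpos.le) ih 2
    refine le_of_mul_le_mul_left (a := x ⬝ᵥ x) ?_ hpos
    calc (x ⬝ᵥ x) * (((A *ᵥ x) ⬝ᵥ (A *ᵥ x)) ^ 2 ^ (r + 1) * (x ⬝ᵥ x))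
        = (((A *ᵥ x) ⬝ᵥ (A *ᵥ x)) ^ 2 ^ r * (x ⬝ᵥ x)) ^ 2 := by
          rw [pow_succ 2 r, pow_mul]; ring
      _ ≤ (((B *ᵥ x) ⬝ᵥ (B *ᵥ x)) * (x ⬝ᵥ x) ^ 2 ^ r) ^ 2 := h₂
      _ = ((B *ᵥ x) ⬝ᵥ (B *ᵥ x)) ^ 2 * (x ⬝ᵥ x) ^ 2 ^ (r + 1) := by
          rw [pow_succ 2 r, pow_mul]; ring
      _ ≤ (x ⬝ᵥ x) * ((A ^ 2 ^ (r + 1) *ᵥ x) ⬝ᵥ (A ^ 2 ^ (r + 1) *ᵥ x)) *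
          (x ⬝ᵥ x) ^ 2 ^ (r + 1) :=
          mul_le_mul_of_nonneg_right h₁ (pow_nonneg hpos.le _)
      _ = _ := by ring

theorem sq_dotProduct_mulVec_le {A : Matrix V V ℝ} (hA : A.IsSymm) (r : ℕ) {Λ : ℝ} (hΛ : 0 ≤ Λ)
    (hT : (A ^ (2 * 2 ^ r)).trace ≤ Λ ^ 2 ^ r) (x y : V → ℝ) :
    (y ⬝ᵥ (A *ᵥ x)) ^ 2 ≤ Λ * ((x ⬝ᵥ x) * (y ⬝ᵥ y)) := by
  have hnn : ∀ y : V → ℝ, 0 ≤ y ⬝ᵥ y := fun y =>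
    Finset.sum_nonneg fun u _ => mul_self_nonneg _
  have h₁ := dotProduct_sq_le y (A *ᵥ x)
  by_cases hx : x ⬝ᵥ x = 0
  · have : x = 0 := dotProduct_self_eq_zero.1 hx
    subst this
    simp
  have hpos : 0 < x ⬝ᵥ x := lt_of_le_of_ne (hnn x) (Ne.symm hx)
  have h₂ := mulVec_norm_pow_le hA x r
  have h₃ := mulVec_norm_le_trace (hA.pow (2 ^ r)) x
  rw [← pow_mul, mul_comm (2 ^ r) 2] at h₃
  have h₄ : ((A *ᵥ x) ⬝ᵥ (A *ᵥ x)) ^ 2 ^ r ≤ (Λ * (x ⬝ᵥ x)) ^ 2 ^ r := by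
    refine le_of_mul_le_mul_right (a := x ⬝ᵥ x) ?_ hpos
    refine h₂.trans ?_
    rw [mul_pow]
    have : (A ^ (2 * 2 ^ r)).trace * (x ⬝ᵥ x) ≤ Λ ^ 2 ^ r * (x ⬝ᵥ x) :=
      mul_le_mul_of_nonneg_right hT hpos.le
    calc _ ≤ (Λ ^ 2 ^ r * (x ⬝ᵥ x)) * (x ⬝ᵥ x) ^ 2 ^ r :=
          mul_le_mul_of_nonneg_right (h₃.trans this) (pow_nonneg hpos.le _)
      _ = _ := by ring
  have h₅ := le_of_pow_le_pow_left₀ (by positivity) (mul_nonneg hΛ hpos.le) h₄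
  calc _ ≤ _ := h₁
    _ ≤ (y ⬝ᵥ y) * (Λ * (x ⬝ᵥ x)) := mul_le_mul_of_nonneg_left h₅ (hnn y)
    _ = _ := by ring

end Spectral

section LatinSquare

open Matrix

variable {V ι : Type*}

/-- The permutation matrix of a symbol in the symmetric Latin square `f`. -/
noncomputable def symbolMatrix (f : V → V → ι) (c : ι) : Matrix V V ℝ :=
  Matrix.of fun u v => if f u v = c then 1 else 0

theorem sum_symbolMatrix_apply [Fintype V] {f : V → V → ι}
    (hf : ∀ u, Function.Bijective (f u)) (c : ι) (u : V) : ∑ v, symbolMatrix f c u v = 1 := by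
  obtain ⟨v, hv, huniq⟩ := (hf u).existsUnique c
  simp only [symbolMatrix, Matrix.of_apply]
  rw [Finset.sum_eq_single v]
  · simp [hv]
  · intro b _ hb
    rw [if_neg]
    exact fun h => hb (huniq b h)
  · simp

theorem symbolMatrix_mem [Fintype V] {f : V → V → ι} (hf : ∀ u, Function.Bijective (f u))
    (hs : ∀ u v, f u v = f v u) (c : ι) : symbolMatrix f c ∈ doublyStochastic ℝ V := by
  rw [mem_doublyStochastic_iff_sum]
  refine ⟨fun u v => ?_, sum_symbolMatrix_apply hf c, fun v => ?_⟩
  · simp only [symbolMatrix, Matrix.of_apply]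
    split_ifs <;> simp
  · rw [← sum_symbolMatrix_apply hf c v]
    exact Finset.sum_congr rfl fun u _ => by simp [symbolMatrix, hs u v]

theorem symbolMatrix_isSymm {f : V → V → ι} (hs : ∀ u v, f u v = f v u) (c : ι) :
    (symbolMatrix f c).IsSymm := by
  ext u v
  simp [symbolMatrix, hs u v]

/-- Some `k` symbols of a symmetric Latin square are distributed almost uniformly. -/
theorem exists_symbols_mixing [Fintype V] [Nonempty V] [Fintype ι] {f : V → V → ι}
    (hf : ∀ u, Function.Bijective (f u))
    (hs : ∀ u v, f u v = f v u) {k r : ℕ} (hk : 2 * 2 ^ r ≤ k)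
    (hn : Fintype.card V ≤ 3 ^ 2 ^ r) :
    ∃ cs : Fin k → ι, ∀ X Y : Finset V,
      ((∑ u ∈ Y, ∑ v ∈ X, ∑ i, symbolMatrix f (cs i) u v) -
        k * X.card * Y.card / Fintype.card V) ^ 2 ≤ 24 * 2 ^ r * k * (X.card * Y.card) := by
  have hcard : Fintype.card ι = Fintype.card V :=
    (Fintype.card_of_bijective (hf (Classical.arbitrary V))).symm
  have : Nonempty ι := ⟨f (Classical.arbitrary V) (Classical.arbitrary V)⟩
  obtain ⟨cs, hcs⟩ := exists_trace_pow_le (fun c => symbolMatrix f c - avgMatrix V)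
    (by
      ext u v
      simp [Matrix.sum_apply, symbolMatrix, avgMatrix, hcard])
    (fun c => ⟨_, symbolMatrix_mem hf hs c, rfl⟩) (m := 2 ^ r) (by positivity) hk
  refine ⟨cs, fun X Y => ?_⟩
  set A : Matrix V V ℝ := ∑ i, (symbolMatrix f (cs i) - avgMatrix V) with hA
  have hAs : A.IsSymm := by
    rw [Matrix.IsSymm, hA, Matrix.transpose_sum]
    refine Finset.sum_congr rfl fun i _ => ?_
    rw [Matrix.transpose_sub, (symbolMatrix_isSymm hs _).eq]
    rfl
  have hT : (A ^ (2 * 2 ^ r)).trace ≤ (24 * 2 ^ r * k : ℝ) ^ 2 ^ r := by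
    refine hcs.trans ?_
    have h₁ : (24 * 2 ^ r * k : ℝ) ^ 2 ^ r = 3 ^ 2 ^ r * (8 * (2 ^ r : ℕ) * k) ^ 2 ^ r := by
      rw [← mul_pow]; push_cast; congr 1; ring
    rw [h₁]
    gcongr
    exact_mod_cast hn
  have h := sq_dotProduct_mulVec_le hAs r (by positivity) hT
    (fun v => if v ∈ X then 1 else 0) (fun v => if v ∈ Y then 1 else 0)
  have h₁ : ∀ Z : Finset V, (fun v => if v ∈ Z then (1 : ℝ) else 0) ⬝ᵥ
      (fun v => if v ∈ Z then (1 : ℝ) else 0) = Z.card := by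
    intro Z
    simp [dotProduct]
  have h₂ : (fun v => if v ∈ Y then (1 : ℝ) else 0) ⬝ᵥ
      (A *ᵥ (fun v => if v ∈ X then (1 : ℝ) else 0)) =
      (∑ u ∈ Y, ∑ v ∈ X, ∑ i, symbolMatrix f (cs i) u v) -
        k * X.card * Y.card / Fintype.card V := by
    simp [dotProduct, mulVec, hA, Matrix.sum_apply, avgMatrix, Finset.sum_sub_distrib]
    ring
  rwa [h₂, h₁, h₁] at h

/-- The graph formed by the cells of `f` carrying one of the symbols `cs i`. -/
def symbolGraph {k : ℕ} (f : V → V → ι) (hs : ∀ u v, f u v = f v u) (cs : Fin k → ι) :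
    SimpleGraph V where
  Adj u v := u ≠ v ∧ ∃ i, f u v = cs i
  symm := ⟨fun u v h => ⟨h.1.symm, by rw [hs]; exact h.2⟩⟩
  loopless := ⟨fun _ h => h.1 rfl⟩

variable {k m : ℕ} {f : V → V → ι} {hs : ∀ u v, f u v = f v u} {cs : Fin k → ι}

theorem joinsLargeSets_symbolGraph [Fintype V] [Nonempty V]
    (hmix : ∀ X Y : Finset V, ((∑ u ∈ Y, ∑ v ∈ X, ∑ i, symbolMatrix f (cs i) u v) -
        k * X.card * Y.card / Fintype.card V : ℝ) ^ 2 ≤ 24 * m * k * (X.card * Y.card))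
    {s : ℕ} (hk : 0 < k) (hsk : (24 * m * Fintype.card V ^ 2 : ℝ) < k * s ^ 2) :
    JoinsLargeSets (symbolGraph f hs cs) s := by
  intro X Y hXY hX hY
  by_contra! hno
  have h0 : ∑ u ∈ Y, ∑ v ∈ X, ∑ i, symbolMatrix f (cs i) u v = 0 := by
    refine Finset.sum_eq_zero fun u hu => Finset.sum_eq_zero fun v hv =>
      Finset.sum_eq_zero fun i _ => ?_
    simp only [symbolMatrix, Matrix.of_apply]
    rw [if_neg]
    intro h
    refine hno v hv u hu ⟨fun h' => ?_, i, by rw [hs]; exact h⟩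
    subst h'
    exact Finset.disjoint_left.1 hXY hv hu
  have h := hmix X Y
  have hn : (0 : ℝ) < Fintype.card V := by exact_mod_cast Fintype.card_pos
  have hk' : (0 : ℝ) < k := by exact_mod_cast hk
  rw [h0, zero_sub, neg_sq, div_pow, div_le_iff₀ (by positivity)] at h
  have hs0 : (0 : ℝ) < s := by
    rcases Nat.eq_zero_or_pos s with h | h
    · subst h
      have : (0 : ℝ) ≤ 24 * m * Fintype.card V ^ 2 := by positivity
      simp at hsk
      linarith
    · exact_mod_cast h
  have hX' : (s : ℝ) ≤ X.card := by exact_mod_cast hX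
  have hY' : (s : ℝ) ≤ Y.card := by exact_mod_cast hY
  have hX0 : (0 : ℝ) < X.card := hs0.trans_le hX'
  have hY0 : (0 : ℝ) < Y.card := hs0.trans_le hY'
  have h₁ : (k : ℝ) * (X.card * Y.card) ≤ 24 * m * Fintype.card V ^ 2 := by
    refine le_of_mul_le_mul_left (a := (k : ℝ) * (X.card * Y.card)) ?_ (by positivity)
    linarith
  have h₂ : (s : ℝ) ^ 2 ≤ X.card * Y.card := by
    rw [sq]; gcongr
  have h₃ : (k : ℝ) * s ^ 2 ≤ k * (X.card * Y.card) := by gcongr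
  linarith

theorem nbhd_symbolGraph_expands [Fintype V] [Nonempty V]
    (hf : ∀ u, Function.Bijective (f u))
    (hmix : ∀ X Y : Finset V, ((∑ u ∈ Y, ∑ v ∈ X, ∑ i, symbolMatrix f (cs i) u v) -
        k * X.card * Y.card / Fintype.card V : ℝ) ^ 2 ≤ 24 * m * k * (X.card * Y.card))
    {D : ℕ} (hk : 0 < k) (hD : 96 * m * D ≤ k) (hm : 0 < m) (X : Finset V) :
    D * X.card ≤ (nbhd (symbolGraph f hs cs) X).card ∨
      Fintype.card V ≤ 2 * (nbhd (symbolGraph f hs cs) X).card := by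
  by_contra! hcon
  obtain ⟨hc₁, hc₂⟩ := hcon
  set Y := nbhd (symbolGraph f hs cs) X with hY
  have he : ∑ u ∈ Y, ∑ v ∈ X, ∑ i, symbolMatrix f (cs i) u v = k * X.card := by
    rw [Finset.sum_comm]
    have : ∀ v ∈ X, ∑ u ∈ Y, ∑ i, symbolMatrix f (cs i) u v = k := by
      intro v hv
      rw [Finset.sum_comm]
      have h₁ : ∀ i, ∑ u ∈ Y, symbolMatrix f (cs i) u v = 1 := by
        intro i
        rw [← sum_symbolMatrix_apply hf (cs i) v]
        simp_rw [symbolMatrix, Matrix.of_apply, hs v]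
        refine Finset.sum_subset (Finset.subset_univ _) fun u _ hu => ?_
        rw [if_neg]
        intro h
        refine hu ?_
        simp only [hY, nbhd, Finset.mem_filter, Finset.mem_univ, true_and]
        by_cases huv : u = v
        · exact Or.inl (huv ▸ hv)
        · exact Or.inr ⟨v, hv, fun h' => huv h'.symm, i, by rw [hs]; exact h⟩
      simp [h₁]
    rw [Finset.sum_congr rfl this]
    simp [mul_comm]
  have h := hmix X Y
  rw [he] at h
  have hn : (0 : ℝ) < Fintype.card V := by exact_mod_cast Fintype.card_pos
  have hk' : (0 : ℝ) < k := by exact_mod_cast hk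
  have hm' : (0 : ℝ) < m := by exact_mod_cast hm
  have hX0 : (0 : ℝ) < X.card := by
    have : 0 < X.card := by
      by_contra! h0
      have h0 : X.card = 0 := by omega
      rw [h0] at hc₁
      omega
    exact_mod_cast this
  have hYn : (2 * Y.card : ℝ) < Fintype.card V := by exact_mod_cast hc₂
  have h₁ : (k * X.card : ℝ) / 2 ≤ k * X.card - k * X.card * Y.card / Fintype.card V := by
    have : (k * X.card * Y.card : ℝ) / Fintype.card V ≤ k * X.card / 2 := by
      rw [div_le_iff₀ hn]
      have : (k * X.card : ℝ) * (2 * Y.card) ≤ k * X.card * Fintype.card V := by gcongr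
      linarith
    linarith
  have h₂ : ((k * X.card : ℝ) / 2) ^ 2 ≤ 24 * m * k * (X.card * Y.card) :=
    (pow_le_pow_left₀ (by positivity) h₁ 2).trans h
  have h₃ : (k : ℝ) * X.card ≤ 96 * m * Y.card := by
    refine le_of_mul_le_mul_left (a := (k : ℝ) * X.card) ?_ (by positivity)
    linarith
  have h₄ : (96 * m * D : ℝ) * X.card ≤ k * X.card := by
    gcongr
    exact_mod_cast hD
  have h₅ : (Y.card : ℝ) < D * X.card := by exact_mod_cast hc₁
  have h₆ : (96 * m : ℝ) * Y.card < 96 * m * (D * X.card) := by gcongr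
  linarith

end LatinSquare

theorem Fintype.exists_bijective_extend_point {V ι : Type*} [Fintype V] [DecidableEq V]
    [Fintype ι] (hc : Fintype.card ι = Fintype.card V) (u : V) (g : V → ι)
    (hg : ∀ v w, v ≠ u → w ≠ u → g v = g w → v = w) :
    ∃ x : ι, Function.Bijective (Function.update g u x) := by
  have hlt : ((Finset.univ.erase u).image g).card < Fintype.card ι := by
    refine Finset.card_image_le.trans_lt ?_
    rw [Finset.card_erase_of_mem (Finset.mem_univ u), Finset.card_univ, hc]
    exact Nat.sub_lt (Fintype.card_pos_iff.2 ⟨u⟩) one_pos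
  obtain ⟨x, hx⟩ : ∃ x, x ∉ (Finset.univ.erase u).image g := by
    by_contra! h
    rw [← Finset.card_univ, Finset.eq_univ_of_forall h] at hlt
    exact lt_irrefl _ hlt
  have hx' : ∀ v, v ≠ u → g v ≠ x := fun v hv h =>
    hx (Finset.mem_image.2 ⟨v, by simp [hv], h⟩)
  refine ⟨x, (Fintype.bijective_iff_injective_and_card _).2 ⟨?_, hc.symm⟩⟩
  intro v w h
  by_cases hv : v = u <;> by_cases hw : w = u
  · rw [hv, hw]
  · subst hv
    rw [Function.update_self, Function.update_of_ne hw] at h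
    exact absurd h.symm (hx' w hw)
  · subst hw
    rw [Function.update_self, Function.update_of_ne hv] at h
    exact absurd h (hx' v hv)
  · rw [Function.update_of_ne hv, Function.update_of_ne hw] at h
    exact hg v w hv hw h

/-- A proper colouring of a complete graph with few colours extends to a symmetric Latin square. -/
theorem exists_latinSquare {n : ℕ} (hn : 0 < n) {c : Sym2 (Fin n) → ℕ}
    (hc : ∀ u v w : Fin n, v ≠ u → w ≠ u → c s(u, v) = c s(u, w) → v = w)
    {C : Finset ℕ} (hC : C.card ≤ n) (hcC : ∀ u v : Fin n, u ≠ v → c s(u, v) ∈ C) :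
    ∃ (f : Fin n → Fin n → Fin n) (e : ℕ → Fin n), Set.InjOn e C ∧
      (∀ u, Function.Bijective (f u)) ∧ (∀ u v, f u v = f v u) ∧
      ∀ u v, u ≠ v → f u v = e (c s(u, v)) := by
  obtain ⟨φ⟩ : Nonempty (C ↪ Fin n) := Function.Embedding.nonempty_of_card_le (by simpa using hC)
  let e : ℕ → Fin n := fun a => if h : a ∈ C then φ ⟨a, h⟩ else ⟨0, hn⟩
  have he : Set.InjOn e C := by
    intro a ha b hb hab
    simp only [Finset.mem_coe] at ha hb
    simpa [e, ha, hb] using hab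
  choose x hx using fun u => Fintype.exists_bijective_extend_point (ι := Fin n) rfl u
    (fun v => e (c s(u, v))) fun v w hv hw h =>
      hc u v w hv hw (he (hcC u v hv.symm) (hcC u w hw.symm) h)
  refine ⟨_, e, he, hx, fun u v => ?_, fun u v huv => Function.update_of_ne huv.symm _ _⟩
  by_cases huv : u = v
  · rw [huv]
  · rw [Function.update_of_ne huv, Function.update_of_ne (Ne.symm huv), Sym2.eq_swap]

theorem exists_walk_of_isChain {V : Type*} (G : SimpleGraph V) (l : List V) :
    ∀ u : V, (u :: l).IsChain G.Adj → ∃ (v : V) (p : (⊤ : SimpleGraph V).Walk u v),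
      p.support = u :: l ∧ ∀ e ∈ p.edges, ∃ a b, G.Adj a b ∧ e = s(a, b) := by
  induction l with
  | nil => exact fun u _ => ⟨u, .nil, rfl, by simp⟩
  | cons w l ih =>
    intro u h
    rw [List.isChain_cons_cons] at h
    obtain ⟨v, p, hp, he⟩ := ih w h.2
    refine ⟨v, .cons ((SimpleGraph.top_adj _ _).2 h.1.ne) p, by simp [hp], ?_⟩
    intro e h'
    rw [SimpleGraph.Walk.edges_cons, List.mem_cons] at h'
    rcases h' with rfl | h'
    · exact ⟨u, w, h.1, rfl⟩
    · exact he e h'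

theorem exists_isHamiltonian_card_colors_le {n : ℕ} (hn : 0 < n) {c : Sym2 (Fin n) → ℕ}
    (hc : ∀ u v w : Fin n, v ≠ u → w ≠ u → c s(u, v) = c s(u, w) → v = w)
    {C : Finset ℕ} (hC : C.card ≤ n) (hcC : ∀ u v : Fin n, u ≠ v → c s(u, v) ∈ C)
    {k r s t M : ℕ} (hk : 2 * 2 ^ r ≤ k) (hr : n ≤ 3 ^ 2 ^ r) (hs : 24 * 2 ^ r * n ^ 2 < k * s ^ 2)
    (hM : 96 * 2 ^ r * (3 * M + 2) ≤ k) (ht : 4 * s < M ^ t)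
    (hst : (4 * t + 8) * (20 * s) + s ≤ n) :
    ∃ (u v : Fin n) (p : (⊤ : SimpleGraph (Fin n)).Walk u v),
      p.IsHamiltonian ∧ (p.edges.map c).toFinset.card ≤ k := by
  have : Nonempty (Fin n) := ⟨⟨0, hn⟩⟩
  have hr0 : 0 < 2 ^ r := by positivity
  have hk0 : 0 < k := by omega
  have hs0 : 0 < s := by
    rcases Nat.eq_zero_or_pos s with rfl | h
    · simp at hs
    · exact h
  obtain ⟨f, e, he, hf, hsymm, hfe⟩ := exists_latinSquare hn hc hC hcC
  obtain ⟨cs, hmix⟩ := exists_symbols_mixing hf hsymm hk (by simpa using hr)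
  replace hmix : ∀ X Y : Finset (Fin n),
      ((∑ u ∈ Y, ∑ v ∈ X, ∑ i, symbolMatrix f (cs i) u v) -
        k * X.card * Y.card / Fintype.card (Fin n) : ℝ) ^ 2 ≤
        24 * (2 ^ r : ℕ) * k * (X.card * Y.card) := by
    intro X Y
    push_cast
    exact hmix X Y
  obtain ⟨P, hchain, hnodup, hP⟩ := exists_hamiltonian_list (symbolGraph f hsymm cs) hs0
    (joinsLargeSets_symbolGraph hmix hk0 (by rw [Fintype.card_fin]; exact_mod_cast hs))
    (nbhd_symbolGraph_expands hf hmix hk0 hM hr0) ht (by simpa using hst)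
  obtain ⟨u, l, rfl⟩ : ∃ u l, P = u :: l :=
    List.exists_cons_of_ne_nil (List.ne_nil_of_mem (hP ⟨0, hn⟩))
  obtain ⟨v, p, hp, hpe⟩ := exists_walk_of_isChain _ l u hchain
  refine ⟨u, v, p, fun w => ?_, ?_⟩
  · rw [hp]
    convert List.count_eq_one_of_mem hnodup (hP w)
  · calc (p.edges.map c).toFinset.card
        ≤ (Finset.univ.image cs).card := by
          refine Finset.card_le_card_of_injOn e ?_ ?_
          · intro a ha
            simp only [List.coe_toFinset, List.mem_map, Set.mem_ofPred_eq] at ha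
            obtain ⟨_, hx, rfl⟩ := ha
            obtain ⟨a, b, ⟨hab, i, hi⟩, rfl⟩ := hpe _ hx
            simp [← hfe a b hab, hi]
          · refine he.mono fun a ha => ?_
            simp only [List.coe_toFinset, List.mem_map, Set.mem_ofPred_eq] at ha
            obtain ⟨_, hx, rfl⟩ := ha
            obtain ⟨a, b, ⟨hab, -⟩, rfl⟩ := hpe _ hx
            exact hcC a b hab
      _ ≤ k := Finset.card_image_le.trans (by simp)

end

theorem exists_parameters {M : ℕ} (hM : 1600 ≤ Real.log M) {n : ℕ}
    (hL₁ : 10000 ≤ Real.log n) (hL₂ : (192 * (3 * M + 2) : ℝ) ≤ Real.log n) :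
    ∃ k r s t : ℕ, (k : ℝ) ≤ Real.log (n + 1) ^ 3 ∧ 2 * 2 ^ r ≤ k ∧ n ≤ 3 ^ 2 ^ r ∧
      24 * 2 ^ r * n ^ 2 < k * s ^ 2 ∧ 96 * 2 ^ r * (3 * M + 2) ≤ k ∧ 4 * s < M ^ t ∧
      (4 * t + 8) * (20 * s) + s ≤ n := by
  have hn₀ : (0 : ℝ) < n := by
    rcases Nat.eq_zero_or_pos n with rfl | h
    · norm_num at hL₁
    · exact_mod_cast h
  have hM₀ : (0 : ℝ) < M := by
    rcases Nat.eq_zero_or_pos M with rfl | h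
    · norm_num at hM
    · exact_mod_cast h
  set L := Real.log n with hL
  have hexpL : Real.exp L = n := Real.exp_log hn₀
  have hLn : L ≤ n := (Real.log_le_sub_one_of_pos hn₀).trans (by linarith)
  have hL₀ : 0 < L := by linarith
  obtain ⟨r, hr₁, hr₂⟩ := exists_nat_pow_near (x := L) (y := 2) (by linarith) (by norm_num)
  have hr₃ : (2 : ℝ) ^ (r + 1) ≤ 2 * L := by rw [pow_succ]; linarith
  have hlog : L ^ 3 ≤ Real.log (n + 1) ^ 3 := by
    gcongr
    exact Real.log_le_log hn₀ (by linarith)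
  set k := ⌊Real.log (n + 1) ^ 3⌋₊ with hk
  set s := ⌈10 * n / L⌉₊ with hs
  set t := ⌈L / Real.log M⌉₊ with ht
  have hk₁ : (k : ℝ) ≤ Real.log (n + 1) ^ 3 := Nat.floor_le ((by positivity : 0 ≤ L ^ 3).trans hlog)
  have hk₂ : L ^ 3 - 1 ≤ k := by
    have := Nat.lt_floor_add_one (Real.log (n + 1) ^ 3 : ℝ)
    linarith
  have hs₁ : 10 * n / L ≤ s := Nat.le_ceil _
  have hs₂ : s ≤ 10 * n / L + 1 := (Nat.ceil_lt_add_one (by positivity)).le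
  have ht₁ : L / Real.log M ≤ t := Nat.le_ceil _
  have ht₂ : t ≤ L / 1600 + 1 := by
    refine (Nat.ceil_lt_add_one (div_nonneg hL₀.le (by linarith))).le.trans ?_
    gcongr
  have hnL : (n : ℝ) / L ≤ n / 10000 := by gcongr
  have hs₃ : (s : ℝ) ≤ n / 1000 + 1 := by
    have : 10 * n / L = 10 * (n / L) := by ring
    linarith
  have hk₃ : L ^ 2 + 1 ≤ L ^ 3 - 1 := by nlinarith
  refine ⟨k, r + 1, s, t, hk₁, ?_, ?_, ?_, ?_, ?_, ?_⟩
  · have : (2 * 2 ^ (r + 1) : ℝ) ≤ k := by nlinarith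
    exact_mod_cast this
  · have : (n : ℝ) ≤ 3 ^ 2 ^ (r + 1) := by
      calc (n : ℝ) = Real.exp L := hexpL.symm
        _ ≤ Real.exp ((2 ^ (r + 1) : ℕ) * 1) := by
          rw [mul_one]
          push_cast
          exact Real.exp_le_exp.2 hr₂.le
        _ = Real.exp 1 ^ 2 ^ (r + 1) := Real.exp_nat_mul _ _
        _ ≤ 3 ^ 2 ^ (r + 1) := by
          gcongr
          exact Real.exp_one_lt_three.le
    exact_mod_cast this
  · have : (24 * 2 ^ (r + 1) * n ^ 2 : ℝ) < k * s ^ 2 := by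
      have h₁ : (24 * 2 ^ (r + 1) * n ^ 2 : ℝ) ≤ 48 * L * n ^ 2 := by
        have : (24 * 2 ^ (r + 1) : ℝ) ≤ 48 * L := by linarith
        gcongr
      have h₂ : (L ^ 3 / 2) * (10 * n / L) ^ 2 ≤ k * s ^ 2 := by
        have : L ^ 3 / 2 ≤ k := by nlinarith
        gcongr
      have h₃ : (L ^ 3 / 2) * (10 * n / L) ^ 2 = 50 * L * n ^ 2 := by
        field_simp
        norm_num
      have h₄ : 0 < L * n ^ 2 := by positivity
      linarith
    exact_mod_cast this
  · have : (96 * 2 ^ (r + 1) * (3 * M + 2) : ℝ) ≤ k := by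
      have h₁ : (96 * 2 ^ (r + 1) * (3 * M + 2) : ℝ) ≤ 96 * (2 * L) * (3 * M + 2) := by gcongr
      have h₂ : L * (192 * (3 * M + 2)) ≤ L * L := by gcongr
      linarith
    exact_mod_cast this
  · have h₁ : (n : ℝ) ≤ M ^ t := by
      calc (n : ℝ) = Real.exp L := hexpL.symm
        _ ≤ Real.exp (t * Real.log M) := by
          refine Real.exp_le_exp.2 ?_
          rwa [div_le_iff₀ (by linarith)] at ht₁
        _ = M ^ t := by rw [Real.exp_nat_mul, Real.exp_log hM₀]
    have : (4 * s : ℝ) < M ^ t := by linarith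
    exact_mod_cast this
  · have h₁ : ((4 * t + 8) * (20 * s) + s : ℝ) ≤ (10 * n / L + 1) * (L / 20 + 241) := by
      calc ((4 * t + 8) * (20 * s) + s : ℝ) = s * (80 * t + 161) := by ring
        _ ≤ (10 * n / L + 1) * (L / 20 + 241) := by
          exact mul_le_mul hs₂ (by linarith) (by positivity) (by positivity)
    have h₂ : (10 * n / L + 1) * (L / 20 + 241) = n / 2 + 2410 * (n / L) + L / 20 + 241 := by
      field_simp
      ring
    have : ((4 * t + 8) * (20 * s) + s : ℝ) ≤ n := by linarith
    exact_mod_cast this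

/-- For sufficiently large odd `n`, every proper edge colouring of `K_n` with at most
`n` colours has a Hamilton path with at most `(log (n+1))^3` colours. -/
theorem statement2 :
    ∃ N : ℕ, ∀ n : ℕ, N ≤ n → Odd n →
      ∀ c : Sym2 (Fin n) → ℕ,
        IsProperEdgeColoring c →
        ((((⊤ : SimpleGraph (Fin n)).edgeFinset).image c).card ≤ n) →
        ∃ (u v : Fin n) (p : (⊤ : SimpleGraph (Fin n)).Walk u v),
          p.IsHamiltonian ∧
          (((p.edges.map c).toFinset.card : ℝ) ≤ Real.log (n + 1) ^ 3) := by
  set M : ℕ := ⌈Real.exp 1600⌉₊ with hMdef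
  have hM : 1600 ≤ Real.log M := by
    rw [Real.le_log_iff_exp_le ((Real.exp_pos _).trans_le (Nat.le_ceil _))]
    exact Nat.le_ceil _
  have hlog := Real.tendsto_log_atTop.comp tendsto_natCast_atTop_atTop
  obtain ⟨N, hN⟩ := Filter.eventually_atTop.1
    (((hlog.eventually_ge_atTop 10000).and
      (hlog.eventually_ge_atTop (192 * (3 * M + 2)))).and (Filter.eventually_gt_atTop 0))
  refine ⟨N, fun n hn _ c hc hcard => ?_⟩
  obtain ⟨⟨h₁, h₂⟩, h₀⟩ := hN n hn
  obtain ⟨k, r, s, t, hk, h⟩ := exists_parameters hM h₁ h₂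
  obtain ⟨u, v, p, hp, hpk⟩ := exists_isHamiltonian_card_colors_le h₀ (c := c)
    (fun u v w hv hw h => by
      by_contra hvw
      refine hc s(u, v) s(u, w) (by simpa using hv.symm) (by simpa using hw.symm) ?_
        ⟨u, by simp, by simp⟩ h
      intro h'
      rw [Sym2.congr_right] at h'
      exact hvw h')
    hcard (fun u v huv => Finset.mem_image_of_mem _ (by simpa using huv))
    h.1 h.2.1 h.2.2.1 h.2.2.2.1 h.2.2.2.2.1 h.2.2.2.2.2
  exact ⟨u, v, p, hp, (Nat.cast_le.2 hpk).trans hk⟩
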